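/- arXiv:2410.10052 — 4 statements merged into one kernel-verified Lean document; each statement's English description precedes it below -/
import Mathlib

section
/- Fix γ < -1, 0 < ρ < 1, C₀ > 1, 0 < c₁ ≤ c₂ and constants C_k (k ≥ 2). Let a : ℝ → ℝ be smooth with c₁⟨ζ⟩^γ ≤ a''(ζ) ≤ c₂⟨ζ⟩^γ and |a^{(k)}(ζ)| ≤ C_k⟨ζ⟩^{γ+2-k} for all ζ ∈ ℝ and k ≥ 2, where ⟨ζ⟩ := (1+ζ²)^{1/2}, and let v := -lim_{ζ→+∞} a'(ζ). Let λ ≥ 1 and let I, J ⊂ [λ, C₀λ] be closed intervals with min J - max I ≥ ρλ. With p(ξ,η) := -(a(ξ)-a(η))/(ξ-η) (extended by -a'(ξ) on the diagonal), j⁴(ξ) := p(ξ₁,ξ₂) - p(ξ₃,ξ₄), and q(ζ,ζ') := |a'(ζ)-a'(ζ')|^{1/2}, there exist smooth functions b_I, r_I on a neighborhood of W := I × I × J × J such that for all ξ ∈ W: j⁴(ξ) = q(ξ₁,ξ₄) q(ξ₂,ξ₃) + b_I(ξ)(Δ⁴a(ξ) + v Δ⁴ξ) + r_I(ξ) Δ⁴ξ,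 with |∂^α b_I| ≤ C_α λ^{-1-|α|} and |∂^α r_I| ≤ C_α λ^{γ-|α|} on W, constants depending only on γ, ρ, C₀, α, c₁, c₂ and the C_k. -/
open Set

/-- The momentum symbol `p(ξ,η) = -(a(ξ)-a(η))/(ξ-η)`, extended by `-a'(ξ)` on the diagonal. -/
noncomputable def psym (a : ℝ → ℝ) (ξ η : ℝ) : ℝ :=
  if ξ = η then -deriv a ξ else -((a ξ - a η) / (ξ - η))


noncomputable def Lseg {X : Type} [NormedAddCommGroup X] [NormedSpace ℝ X] (P : X →L[ℝ] X)
    (s : ℝ) : X →L[ℝ] X := P + s • (ContinuousLinearMap.id ℝ X - P)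

lemma Lseg_apply {X : Type} [NormedAddCommGroup X] [NormedSpace ℝ X] (P : X →L[ℝ] X)
    (s : ℝ) (x : X) : Lseg P s x = (1 - s) • P x + s • x := by
  simp [Lseg]; module

lemma Lseg_norm {X : Type} [NormedAddCommGroup X] [NormedSpace ℝ X] (P : X →L[ℝ] X)
    (hP : ‖P‖ ≤ 1) (s : ℝ) (hs : s ∈ Icc (0:ℝ) 1) : ‖Lseg P s‖ ≤ 1 := by
  refine ContinuousLinearMap.opNorm_le_bound _ zero_le_one fun x => ?_
  rw [Lseg_apply, one_mul]
  have h1 : ‖P x‖ ≤ ‖x‖ := by simpa using P.le_of_opNorm_le hP x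
  calc _ ≤ ‖(1 - s) • P x‖ + ‖s • x‖ := norm_add_le _ _
    _ = (1 - s) * ‖P x‖ + s * ‖x‖ := by
      rw [norm_smul, norm_smul, Real.norm_of_nonneg (by linarith [hs.2]),
        Real.norm_of_nonneg hs.1]
    _ ≤ (1 - s) * ‖x‖ + s * ‖x‖ := by
      have : 0 ≤ 1 - s := by linarith [hs.2]
      gcongr
    _ = ‖x‖ := by ring

lemma Lseg_mem {X : Type} [NormedAddCommGroup X] [NormedSpace ℝ X] {U : Set X}
    (hUc : Convex ℝ U) (P : X →L[ℝ] X) (hPU : ∀ x ∈ U, P x ∈ U) (s : ℝ)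
    (hs : s ∈ Icc (0:ℝ) 1) (x : X) (hx : x ∈ U) : Lseg P s x ∈ U := by
  rw [Lseg_apply]
  exact hUc (hPU x hx) hx (by linarith [hs.2]) hs.1 (by ring)

lemma int_aux {X : Type} [NormedAddCommGroup X] [NormedSpace ℝ X] {U : Set X}
    (hU : IsOpen U) (hUc : Convex ℝ U) (P : X →L[ℝ] X) (hPU : ∀ x ∈ U, P x ∈ U)
    (hP : ‖P‖ ≤ 1) (F : X → ℝ) (hF : ContDiffOn ℝ (⊤ : ℕ∞) F U) (C : ℕ → ℝ)
    (hC : ∀ n, ∀ x ∈ U, ‖iteratedFDerivWithin ℝ n F U x‖ ≤ C n) :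
    ContDiffOn ℝ (⊤ : ℕ∞) (fun x => ∫ s in (0:ℝ)..1, F (Lseg P s x)) U ∧
    ∀ n, ∀ x ∈ U,
      ‖iteratedFDerivWithin ℝ n (fun x => ∫ s in (0:ℝ)..1, F (Lseg P s x)) U x‖ ≤ C n := by
  let q : ℝ → X → FormalMultilinearSeries ℝ X ℝ := fun s x n =>
    (iteratedFDerivWithin ℝ n F U (Lseg P s x)).compContinuousLinearMap fun _ => Lseg P s
  have hIoc : ∀ s, s ∈ Set.uIoc (0:ℝ) 1 → s ∈ Icc (0:ℝ) 1 := by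
    intro s hs; rw [Set.uIoc_of_le zero_le_one] at hs; exact ⟨hs.1.le, hs.2⟩
  have hq : ∀ s ∈ Icc (0:ℝ) 1, HasFTaylorSeriesUpToOn (⊤ : ℕ∞) (F ∘ Lseg P s) (q s) U := by
    intro s hs
    have := (hF.ftaylorSeriesWithin hU.uniqueDiffOn).compContinuousLinearMap (Lseg P s)
    exact this.mono (fun x hx => Lseg_mem hUc P hPU s hs x hx)
  have hqb : ∀ s ∈ Icc (0:ℝ) 1, ∀ x ∈ U, ∀ n, ‖q s x n‖ ≤ C n := by
    intro s hs x hx n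
    refine (ContinuousMultilinearMap.norm_compContinuousLinearMap_le _ _).trans ?_
    have h1 := hC n _ (Lseg_mem hUc P hPU s hs x hx)
    have h2 : ∏ i : Fin n, ‖Lseg P s‖ ≤ 1 :=
      Finset.prod_le_one (fun _ _ => norm_nonneg _) (fun _ _ => Lseg_norm P hP s hs)
    calc _ ≤ C n * 1 := mul_le_mul h1 h2 (Finset.prod_nonneg fun _ _ => norm_nonneg _)
            ((norm_nonneg _).trans h1)
      _ = C n := mul_one _
  have hLc : Continuous (fun s => Lseg P s) := by unfold Lseg; fun_prop
  have hqc : ∀ x ∈ U, ∀ n, ContinuousOn (fun s => q s x n) (Icc (0:ℝ) 1) := by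
    intro x hx n
    have h1 : ContinuousOn (fun s => iteratedFDerivWithin ℝ n F U (Lseg P s x)) (Icc (0:ℝ) 1) := by
      refine (hF.continuousOn_iteratedFDerivWithin (by exact_mod_cast le_top)
        hU.uniqueDiffOn).comp (Continuous.continuousOn (by fun_prop)) ?_
      intro s hs; exact Lseg_mem hUc P hPU s hs x hx
    have h2 : Continuous (fun s => ContinuousMultilinearMap.compContinuousLinearMapContinuousMultilinear ℝ
        (fun _ : Fin n => X) (fun _ : Fin n => X) ℝ (fun _ => Lseg P s)) :=
      (ContinuousMultilinearMap.cont _).comp (by fun_prop)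
    exact h2.continuousOn.clm_apply h1
  have hqi : ∀ x ∈ U, ∀ n, IntervalIntegrable (fun s => q s x n) MeasureTheory.volume 0 1 := by
    intro x hx n
    apply ContinuousOn.intervalIntegrable
    rw [Set.uIcc_of_le zero_le_one]; exact hqc x hx n
  let p : X → FormalMultilinearSeries ℝ X ℝ := fun x n => ∫ s in (0:ℝ)..1, q s x n
  have hder : ∀ n, ∀ x ∈ U, HasFDerivAt (p · n) (p x (n+1)).curryLeft x := by
    intro n x hx
    have key := intervalIntegral.hasFDerivAt_integral_of_dominated_of_fderiv_le
      (𝕜 := ℝ) (μ := MeasureTheory.volume) (a := 0) (b := 1)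
      (F := fun x s => q s x n) (F' := fun x s => (q s x (n+1)).curryLeft) (x₀ := x)
      (bound := fun _ => C (n+1)) (hU.mem_nhds hx)
      (by
        filter_upwards [hU.mem_nhds hx] with y hy
        exact (intervalIntegrable_iff.1 (hqi y hy n)).aestronglyMeasurable)
      (hqi x hx n)
      (by
        have := (continuousMultilinearCurryLeftEquiv ℝ (fun _ : Fin (n+1) => X) ℝ).continuous.comp_aestronglyMeasurable
          (intervalIntegrable_iff.1 (hqi x hx (n+1))).aestronglyMeasurable
        exact this)
      (by
        refine Filter.Eventually.of_forall fun s hs y hy => ?_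
        rw [ContinuousMultilinearMap.curryLeft_norm]
        exact hqb s (hIoc s hs) y hy _)
      (by simp)
      (by
        refine Filter.Eventually.of_forall fun s hs y hy => ?_
        exact ((hq s (hIoc s hs)).fderivWithin n (by exact_mod_cast ENat.natCast_lt_top n) y hy).hasFDerivAt
          (hU.mem_nhds hy))
    have e : (∫ s in (0:ℝ)..1, (q s x (n+1)).curryLeft) = (p x (n+1)).curryLeft := by
      let Lc : (X [×(n+1)]→L[ℝ] ℝ) →L[ℝ] (X →L[ℝ] (X [×n]→L[ℝ] ℝ)) :=
        (continuousMultilinearCurryLeftEquiv ℝ (fun _ : Fin (n+1) => X) ℝ).toLinearIsometry.toContinuousLinearMap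
      exact ContinuousLinearMap.intervalIntegral_comp_comm (𝕜 := ℝ) (E := X [×(n+1)]→L[ℝ] ℝ) (F := X →L[ℝ] (X [×n]→L[ℝ] ℝ)) Lc (hqi x hx (n+1))
    rw [e] at key
    exact key
  have hT : HasFTaylorSeriesUpToOn (⊤ : ℕ∞) (fun x => ∫ s in (0:ℝ)..1, F (Lseg P s x)) p U := by
    constructor
    · intro x hx
      have := (continuousMultilinearCurryFin0 ℝ X ℝ).toLinearIsometry.toContinuousLinearMap.intervalIntegral_comp_comm (hqi x hx 0)
      refine this.symm.trans ?_
      apply intervalIntegral.integral_congr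
      intro s hs
      simp [q]
    · intro n _ x hx
      exact (hder n x hx).hasFDerivWithinAt
    · intro n _ x hx
      exact (hder n x hx).continuousAt.continuousWithinAt
  refine ⟨hT.contDiffOn, fun n x hx => ?_⟩
  rw [← hT.eq_iteratedFDerivWithin_of_uniqueDiffOn (by exact_mod_cast le_top) hU.uniqueDiffOn hx]
  have := intervalIntegral.norm_integral_le_of_norm_le_const (a := (0:ℝ)) (b := 1)
    (f := fun s => q s x n) (C := C n) (fun s hs => hqb s (hIoc s hs) x hx n)
  simpa using this

/-- Uniformly bounded families of smooth functions. -/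
def BF {X : Type} [NormedAddCommGroup X] [NormedSpace ℝ X] {ι : Type} (U : ι → Set X)
    (F : ι → X → ℝ) : Prop :=
  (∀ t, ContDiffOn ℝ (⊤ : ℕ∞) (F t) (U t)) ∧
    ∃ C : ℕ → ℝ, ∀ n t, ∀ x ∈ U t, ‖iteratedFDerivWithin ℝ n (F t) (U t) x‖ ≤ C n

section BFsec
variable {X : Type} [NormedAddCommGroup X] [NormedSpace ℝ X] {ι : Type} {U : ι → Set X}
  {F G : ι → X → ℝ}

lemma BF.add (hU : ∀ t, IsOpen (U t)) (hF : BF U F) (hG : BF U G) :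
    BF U (fun t x => F t x + G t x) := by
  obtain ⟨hF1, C, hC⟩ := hF
  obtain ⟨hG1, D, hD⟩ := hG
  refine ⟨fun t => (hF1 t).add (hG1 t), fun n => C n + D n, fun n t x hx => ?_⟩
  have hn : (n : WithTop ℕ∞) ≤ (⊤ : ℕ∞) := by exact_mod_cast le_top
  have := iteratedFDerivWithin_add_apply (((hF1 t) x hx).of_le hn) (((hG1 t) x hx).of_le hn)
    (hU t).uniqueDiffOn hx
  have e : (fun x => F t x + G t x) = F t + G t := rfl
  beta_reduce
  rw [e, this]
  exact (norm_add_le _ _).trans (add_le_add (hC n t x hx) (hD n t x hx))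

lemma BF.neg (hU : ∀ t, IsOpen (U t)) (hF : BF U F) :
    BF U (fun t x => - F t x) := by
  obtain ⟨hF1, C, hC⟩ := hF
  refine ⟨fun t => (hF1 t).neg, C, fun n t x hx => ?_⟩
  have := iteratedFDerivWithin_neg_apply (𝕜 := ℝ) (i := n) (f := F t) (hU t).uniqueDiffOn hx
  have e : (fun x => - F t x) = - F t := rfl
  beta_reduce
  rw [e, this, norm_neg]
  exact hC n t x hx

lemma BF.sub (hU : ∀ t, IsOpen (U t)) (hF : BF U F) (hG : BF U G) :
    BF U (fun t x => F t x - G t x) := by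
  simpa only [sub_eq_add_neg] using hF.add hU (hG.neg hU)

lemma BF.mul (hU : ∀ t, IsOpen (U t)) (hF : BF U F) (hG : BF U G) :
    BF U (fun t x => F t x * G t x) := by
  obtain ⟨hF1, C, hC⟩ := hF
  obtain ⟨hG1, D, hD⟩ := hG
  refine ⟨fun t => (hF1 t).mul (hG1 t),
    fun n => ∑ i ∈ Finset.range (n + 1), (n.choose i : ℝ) * C i * D (n - i), fun n t x hx => ?_⟩
  have hn : (n : WithTop ℕ∞) ≤ (⊤ : ℕ∞) := by exact_mod_cast le_top
  refine (norm_iteratedFDerivWithin_mul_le (hF1 t) (hG1 t) (hU t).uniqueDiffOn hx hn).trans ?_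
  refine Finset.sum_le_sum fun i _ => ?_
  have h1 := hC i t x hx
  have h2 := hD (n - i) t x hx
  have h3 : 0 ≤ C i := (norm_nonneg _).trans h1
  gcongr

lemma BF.comp (hU : ∀ t, IsOpen (U t)) (hF : BF U F) (c : ℝ) (hc : 0 < c)
    (hFc : ∀ t, ∀ x ∈ U t, c ≤ F t x) (g : ℝ → ℝ) (hg : ContDiffOn ℝ (⊤ : ℕ∞) g (Ioi 0)) :
    BF U (fun t x => g (F t x)) := by
  obtain ⟨hF1, C, hC⟩ := hF
  have hmaps : ∀ t, MapsTo (F t) (U t) (Ioi 0) := fun t x hx => hc.trans_le (hFc t x hx)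
  have hK : ∀ i : ℕ, ∃ K : ℝ, ∀ y ∈ Icc c (C 0), ‖iteratedFDerivWithin ℝ i g (Ioi 0) y‖ ≤ K := by
    intro i
    refine isCompact_Icc.exists_bound_of_continuousOn ?_
    refine (hg.continuousOn_iteratedFDerivWithin (by exact_mod_cast le_top)
      isOpen_Ioi.uniqueDiffOn).mono ?_
    intro y hy; exact hc.trans_le hy.1
  choose K hK using hK
  refine ⟨fun t => hg.comp (hF1 t) (hmaps t), fun n => n.factorial *
    (∑ i ∈ Finset.range (n+1), |K i|) * (1 + ∑ i ∈ Finset.range (n+1), |C i|) ^ n,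
    fun n t x hx => ?_⟩
  have hn : (n : WithTop ℕ∞) ≤ (⊤ : ℕ∞) := by exact_mod_cast le_top
  refine norm_iteratedFDerivWithin_comp_le (g := g) (f := F t) hg (hF1 t) hn
    isOpen_Ioi.uniqueDiffOn (hU t).uniqueDiffOn (hmaps t) hx ?_ ?_
  · intro i hi
    have h0 : F t x ≤ C 0 := by
      have := hC 0 t x hx
      rw [norm_iteratedFDerivWithin_zero] at this
      exact (le_abs_self _).trans this
    refine (hK i _ ⟨hFc t x hx, h0⟩).trans ((le_abs_self _).trans ?_)
    exact Finset.single_le_sum (f := fun i => |K i|) (fun _ _ => abs_nonneg _)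
      (Finset.mem_range.2 (by omega))
  · intro i hi1 hi
    have h1 : C i ≤ 1 + ∑ i ∈ Finset.range (n+1), |C i| := by
      have := Finset.single_le_sum (f := fun i => |C i|) (fun _ _ => abs_nonneg _)
        (Finset.mem_range.2 (by omega : i < n + 1))
      have := le_abs_self (C i)
      linarith
    have h2 : 1 ≤ 1 + ∑ i ∈ Finset.range (n+1), |C i| := by
      have : 0 ≤ ∑ i ∈ Finset.range (n+1), |C i| := Finset.sum_nonneg fun _ _ => abs_nonneg _
      linarith
    exact ((hC i t x hx).trans h1).trans (le_self_pow₀ h2 (by omega))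

lemma BF.dir (hU : ∀ t, IsOpen (U t)) (hF : BF U F) (e : X) :
    BF U (fun t x => fderivWithin ℝ (F t) (U t) x e) := by
  obtain ⟨hF1, C, hC⟩ := hF
  have hd : ∀ t, ContDiffOn ℝ (⊤ : ℕ∞) (fderivWithin ℝ (F t) (U t)) (U t) := fun t =>
    (hF1 t).fderivWithin (hU t).uniqueDiffOn (by exact_mod_cast le_top)
  refine ⟨fun t => (hd t).clm_apply contDiffOn_const, fun n => ‖e‖ * C (n+1), fun n t x hx => ?_⟩
  have hn : (n : WithTop ℕ∞) ≤ (⊤ : ℕ∞) := by exact_mod_cast le_top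
  refine (norm_iteratedFDerivWithin_clm_apply_const ((hd t) x hx) (hU t).uniqueDiffOn hx hn).trans ?_
  rw [norm_iteratedFDerivWithin_fderivWithin (hU t).uniqueDiffOn hx]
  exact mul_le_mul_of_nonneg_left (hC _ t x hx) (norm_nonneg _)

lemma BF.int (hU : ∀ t, IsOpen (U t)) (hUc : ∀ t, Convex ℝ (U t)) (P : X →L[ℝ] X)
    (hPU : ∀ t, ∀ x ∈ U t, P x ∈ U t) (hP : ‖P‖ ≤ 1) (hF : BF U F) :
    BF U (fun t x => ∫ s in (0:ℝ)..1, F t (Lseg P s x)) := by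
  obtain ⟨hF1, C, hC⟩ := hF
  refine ⟨fun t => (int_aux (hU t) (hUc t) P (hPU t) hP (F t) (hF1 t) C
    (fun n => hC n t)).1, C, fun n t => (int_aux (hU t) (hUc t) P (hPU t) hP (F t) (hF1 t) C
    (fun n => hC n t)).2 n⟩

end BFsec

lemma BF.coord {ι : Type} {U : ι → Set (Fin 4 → ℝ)} (hU : ∀ t, IsOpen (U t)) (i : Fin 4)
    (A : ι → ℝ → ℝ) (hA : ∀ t, ContDiff ℝ (⊤ : ℕ∞) (A t)) (M : ℕ → ℝ)
    (hM : ∀ n t, ∀ x ∈ U t, |iteratedDeriv n (A t) (x i)| ≤ M n) :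
    BF U (fun t x => A t (x i)) := by
  let π : (Fin 4 → ℝ) →L[ℝ] ℝ := ContinuousLinearMap.proj i
  have hπ : ‖π‖ ≤ 1 := by
    refine ContinuousLinearMap.opNorm_le_bound _ zero_le_one fun x => ?_
    rw [one_mul]; exact norm_le_pi_norm x i
  refine ⟨fun t => ((hA t).comp π.contDiff).contDiffOn, M, fun n t x hx => ?_⟩
  rw [iteratedFDerivWithin_of_isOpen n (hU t) hx]
  have hn : (n : WithTop ℕ∞) ≤ (⊤ : ℕ∞) := by exact_mod_cast le_top
  have e := π.iteratedFDeriv_comp_right (hA t) x hn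
  have e2 : (fun x : Fin 4 → ℝ => A t (x i)) = A t ∘ π := rfl
  beta_reduce
  rw [e2, e]
  refine (ContinuousMultilinearMap.norm_compContinuousLinearMap_le _ _).trans ?_
  have h1 : ‖iteratedFDeriv ℝ n (A t) (π x)‖ ≤ M n := by
    rw [norm_iteratedFDeriv_eq_norm_iteratedDeriv]; exact hM n t x hx
  have h2 : ∏ i : Fin n, ‖π‖ ≤ 1 :=
    Finset.prod_le_one (fun _ _ => norm_nonneg _) (fun _ _ => hπ)
  calc _ ≤ M n * 1 := mul_le_mul h1 h2 (Finset.prod_nonneg fun _ _ => norm_nonneg _)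
          ((norm_nonneg _).trans h1)
    _ = M n := mul_one _
lemma avg_mul (a : ℝ → ℝ) (ha : ContDiff ℝ (⊤ : ℕ∞) a) (x y : ℝ) :
    (∫ s in (0:ℝ)..1, deriv a ((1 - s) * y + s * x)) * (x - y) = a x - a y := by
  have hd : Differentiable ℝ a := ha.differentiable (by simp)
  have hc : Continuous (deriv a) := ha.continuous_deriv (by exact_mod_cast le_top)
  rw [← intervalIntegral.integral_mul_const]
  have key := intervalIntegral.integral_eq_sub_of_hasDerivAt (a := (0:ℝ)) (b := 1)
    (f := fun s => a ((1 - s) * y + s * x))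
    (f' := fun s => deriv a ((1 - s) * y + s * x) * (x - y)) ?_ ?_
  · rw [key]; simp
  · intro s _
    have h1 : HasDerivAt (fun s : ℝ => (1 - s) * y + s * x) (x - y) s := by
      have := (((hasDerivAt_id s).const_sub 1).mul_const y).add ((hasDerivAt_id s).mul_const x)
      refine this.congr_deriv ?_
      ring
    exact (hd _).hasDerivAt.comp s h1
  · apply Continuous.intervalIntegrable
    fun_prop

lemma psym_eq (a : ℝ → ℝ) (ha : ContDiff ℝ (⊤ : ℕ∞) a) (x y : ℝ) :
    psym a x y = - ∫ s in (0:ℝ)..1, deriv a ((1 - s) * y + s * x) := by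
  unfold psym
  split_ifs with h
  · subst h
    have : ∀ s : ℝ, (1 - s) * x + s * x = x := fun s => by ring
    simp [this]
  · rw [← avg_mul a ha x y, mul_div_cancel_right₀ _ (sub_ne_zero.2 h)]

structure CD (M : ℕ → ℝ) (c δ : ℝ) : Type where
  a : ℝ → ℝ
  i1 : ℝ
  i2 : ℝ
  j1 : ℝ
  j2 : ℝ
  ha : ContDiff ℝ (⊤ : ℕ∞) a
  hM : ∀ n, ∀ x ∈ Ioo i1 j2, |iteratedDeriv n (deriv a) x| ≤ M n
  hc : ∀ x ∈ Ioo i1 j2, c ≤ deriv (deriv a) x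
  hsep : i2 + δ ≤ j1

def CD.U {M : ℕ → ℝ} {c δ : ℝ} (t : CD M c δ) : Set (Fin 4 → ℝ) :=
  {x | x 0 ∈ Ioo t.i1 t.i2 ∧ x 1 ∈ Ioo t.i1 t.i2 ∧ x 2 ∈ Ioo t.j1 t.j2 ∧ x 3 ∈ Ioo t.j1 t.j2}

lemma CD.isOpen {M : ℕ → ℝ} {c δ : ℝ} (t : CD M c δ) : IsOpen t.U := by
  have h : ∀ (i : Fin 4) (a b : ℝ), IsOpen {x : Fin 4 → ℝ | x i ∈ Ioo a b} := fun i a b =>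
    isOpen_Ioo.preimage (continuous_apply i)
  exact (h 0 _ _).inter ((h 1 _ _).inter ((h 2 _ _).inter (h 3 _ _)))

lemma CD.convex {M : ℕ → ℝ} {c δ : ℝ} (t : CD M c δ) : Convex ℝ t.U := by
  have h : ∀ (i : Fin 4) (a b : ℝ), Convex ℝ {x : Fin 4 → ℝ | x i ∈ Ioo a b} := fun i a b =>
    (convex_Ioo a b).linear_preimage (LinearMap.proj (R := ℝ) (φ := fun _ : Fin 4 => ℝ) i)
  exact (h 0 _ _).inter ((h 1 _ _).inter ((h 2 _ _).inter (h 3 _ _)))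

noncomputable def PP : (Fin 4 → ℝ) →L[ℝ] (Fin 4 → ℝ) :=
  ContinuousLinearMap.pi fun i => ContinuousLinearMap.proj ((![1, 1, 2, 2] : Fin 4 → Fin 4) i)

lemma PP_norm : ‖PP‖ ≤ 1 := by
  refine ContinuousLinearMap.opNorm_le_bound _ zero_le_one fun x => ?_
  rw [one_mul, pi_norm_le_iff_of_nonneg (norm_nonneg _)]
  intro i
  exact norm_le_pi_norm x _

lemma PP_apply (x : Fin 4 → ℝ) : PP x 0 = x 1 ∧ PP x 1 = x 1 ∧ PP x 2 = x 2 ∧ PP x 3 = x 2 := by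
  simp [PP]

lemma LP_apply (x : Fin 4 → ℝ) (s : ℝ) : Lseg PP s x 0 = (1 - s) * x 1 + s * x 0 ∧
    Lseg PP s x 1 = x 1 ∧ Lseg PP s x 2 = x 2 ∧ Lseg PP s x 3 = (1 - s) * x 2 + s * x 3 := by
  obtain ⟨h0, h1, h2, h3⟩ := PP_apply x
  rw [Lseg_apply]
  simp only [Pi.add_apply, Pi.smul_apply, smul_eq_mul, h0, h1, h2, h3, true_and]
  refine ⟨by ring, by ring, trivial⟩

lemma CD.mapsPP {M : ℕ → ℝ} {c δ : ℝ} (t : CD M c δ) : ∀ x ∈ t.U, PP x ∈ t.U := by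
  intro x hx
  obtain ⟨h0, h1, h2, h3⟩ := PP_apply x
  refine ⟨?_, ?_, ?_, ?_⟩
  · rw [h0]; exact hx.2.1
  · rw [h1]; exact hx.2.1
  · rw [h2]; exact hx.2.2.1
  · rw [h3]; exact hx.2.2.1

lemma CD.gap {M : ℕ → ℝ} {c δ : ℝ} (hc : 0 < c) (hδ : 0 < δ) (t : CD M c δ) (x y : ℝ)
    (hx : x ∈ Ioo t.i1 t.i2) (hy : y ∈ Ioo t.j1 t.j2) : c * δ ≤ deriv t.a y - deriv t.a x := by
  have hd : ContDiff ℝ (⊤ : ℕ∞) (deriv t.a) := (contDiff_infty_iff_deriv.1 t.ha).2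
  have hs := t.hsep
  have hxy : δ ≤ y - x := by linarith [hx.2, hy.1]
  have := (convex_Ioo t.i1 t.j2).mul_sub_le_image_sub_of_le_deriv (f := deriv t.a)
    hd.continuous.continuousOn (hd.differentiable (by simp)).differentiableOn
    (C := c) (by rw [interior_Ioo]; exact t.hc) x ⟨hx.1, by linarith [hy.2]⟩ y
    ⟨by linarith [hx.1], hy.2⟩ (by linarith)
  refine le_trans ?_ this
  gcongr

lemma core (M : ℕ → ℝ) (c δ : ℝ) (hc : 0 < c) (hδ : 0 < δ) :
    ∃ C : ℕ → ℝ, ∀ t : CD M c δ, ∃ b r : (Fin 4 → ℝ) → ℝ,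
      ContDiffOn ℝ (⊤ : ℕ∞) b t.U ∧ ContDiffOn ℝ (⊤ : ℕ∞) r t.U ∧
      ∀ x ∈ t.U, (psym t.a (x 0) (x 1) - psym t.a (x 2) (x 3) =
        Real.sqrt |deriv t.a (x 0) - deriv t.a (x 3)| *
          Real.sqrt |deriv t.a (x 1) - deriv t.a (x 2)| +
        b x * (t.a (x 0) - t.a (x 1) + t.a (x 2) - t.a (x 3)) +
        r x * (x 0 - x 1 + x 2 - x 3)) ∧
      ∀ n : ℕ, ‖iteratedFDeriv ℝ n b x‖ ≤ C n ∧ ‖iteratedFDeriv ℝ n r x‖ ≤ C n := by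
  have hU : ∀ t : CD M c δ, IsOpen t.U := CD.isOpen
  have hAd : ∀ t : CD M c δ, ContDiff ℝ (⊤ : ℕ∞) (deriv t.a) :=
    fun t => (contDiff_infty_iff_deriv.1 t.ha).2
  have hmemIJ : ∀ (t : CD M c δ), ∀ x ∈ t.U, ∀ i : Fin 4, x i ∈ Ioo t.i1 t.j2 := by
    intro t x hx i
    obtain ⟨⟨h0, h0'⟩, ⟨h1, h1'⟩, ⟨h2, h2'⟩, ⟨h3, h3'⟩⟩ := hx
    have := t.hsep
    fin_cases i <;> refine ⟨?_, ?_⟩ <;> simp <;> linarith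
  have hco : ∀ i : Fin 4, BF (CD.U (M := M) (c := c) (δ := δ)) (fun t x => deriv t.a (x i)) :=
    fun i => BF.coord hU i (fun t => deriv t.a) hAd M
      (fun n t x hx => t.hM n _ (hmemIJ t x hx i))
  have hL : ∀ (t : CD M c δ), ∀ s ∈ Icc (0:ℝ) 1, ∀ x ∈ t.U, Lseg PP s x ∈ t.U :=
    fun t s hs x hx => Lseg_mem t.convex PP t.mapsPP s hs x hx
  let f : CD M c δ → (Fin 4 → ℝ) → ℝ := fun t x => ∫ s in (0:ℝ)..1, deriv t.a (Lseg PP s x 0)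
  let g : CD M c δ → (Fin 4 → ℝ) → ℝ := fun t x => ∫ s in (0:ℝ)..1, deriv t.a (Lseg PP s x 3)
  have hf : BF CD.U f := BF.int hU CD.convex PP CD.mapsPP PP_norm (hco 0)
  have hg : BF CD.U g := BF.int hU CD.convex PP CD.mapsPP PP_norm (hco 3)
  have hfp : ∀ t x, psym t.a (x 0) (x 1) = - f t x := by
    intro t x
    rw [psym_eq _ t.ha]
    simp only [f, (LP_apply x _).1]
  have hgp : ∀ t x, psym t.a (x 2) (x 3) = - g t x := by
    intro t x
    have hsym : psym t.a (x 2) (x 3) = psym t.a (x 3) (x 2) := by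
      unfold psym
      by_cases h : x 2 = x 3
      · simp [h]
      · rw [if_neg h, if_neg (Ne.symm h), ← neg_sub (t.a (x 3)), ← neg_sub (x 3), neg_div_neg_eq]
    rw [hsym, psym_eq _ t.ha]
    simp only [g, (LP_apply x _).2.2.2]
  have hfa : ∀ t x, f t x * (x 0 - x 1) = t.a (x 0) - t.a (x 1) := by
    intro t x
    rw [← avg_mul _ t.ha]
    simp only [f, (LP_apply x _).1]
  have hga : ∀ t x, g t x * (x 3 - x 2) = t.a (x 3) - t.a (x 2) := by
    intro t x
    rw [← avg_mul _ t.ha]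
    simp only [g, (LP_apply x _).2.2.2]
  have hj : BF CD.U (fun t x => g t x - f t x) := hg.sub hU hf
  have hcδ : 0 < c * δ := mul_pos hc hδ
  have hLc : ∀ x : Fin 4 → ℝ, Continuous (fun s : ℝ => Lseg PP s x) := by
    intro x; unfold Lseg; fun_prop
  have hjc : ∀ t, ∀ x ∈ t.U, c * δ ≤ g t x - f t x := by
    intro t x hx
    have hint : ∀ i : Fin 4, IntervalIntegrable (fun s => deriv t.a (Lseg PP s x i))
        MeasureTheory.volume 0 1 := fun i =>
      ((hAd t).continuous.comp ((continuous_apply i).comp (hLc x))).intervalIntegrable _ _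
    simp only [f, g]
    rw [← intervalIntegral.integral_sub (hint 3) (hint 0)]
    have := intervalIntegral.integral_mono_on (a := (0:ℝ)) (b := 1) zero_le_one
      (f := fun _ => c * δ) (by simp) ((hint 3).sub (hint 0)) (fun s hs => by
        have := hL t s hs x hx
        exact t.gap hc hδ _ _ this.1 this.2.2.2)
    simpa using this
  have h14 : ∀ t : CD M c δ, ∀ x ∈ t.U, c * δ ≤ deriv t.a (x 3) - deriv t.a (x 0) :=
    fun t x hx => t.gap hc hδ _ _ hx.1 hx.2.2.2
  have h23 : ∀ t : CD M c δ, ∀ x ∈ t.U, c * δ ≤ deriv t.a (x 2) - deriv t.a (x 1) :=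
    fun t x hx => t.gap hc hδ _ _ hx.2.1 hx.2.2.1
  have hsq : ContDiffOn ℝ (⊤ : ℕ∞) Real.sqrt (Ioi 0) := fun y hy =>
    (Real.contDiffAt_sqrt (ne_of_gt hy)).contDiffWithinAt
  have hinv : ContDiffOn ℝ (⊤ : ℕ∞) (fun y : ℝ => y⁻¹) (Ioi 0) := fun y hy =>
    (contDiffAt_inv ℝ (ne_of_gt hy)).contDiffWithinAt
  have hq14 := ((hco 3).sub hU (hco 0)).comp hU (c * δ) hcδ h14 _ hsq
  have hq23 := ((hco 2).sub hU (hco 1)).comp hU (c * δ) hcδ h23 _ hsq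
  have hji := hj.comp hU (c * δ) hcδ hjc _ hinv
  let G : CD M c δ → (Fin 4 → ℝ) → ℝ := fun t x => (g t x - f t x) -
    Real.sqrt (deriv t.a (x 3) - deriv t.a (x 0)) * Real.sqrt (deriv t.a (x 2) - deriv t.a (x 1))
  have hG : BF CD.U G := hj.sub hU (hq14.mul hU hq23)
  let e0 : Fin 4 → ℝ := Pi.single 0 1
  let e3 : Fin 4 → ℝ := Pi.single 3 1
  let B : CD M c δ → (Fin 4 → ℝ) → ℝ := fun t x =>
    ∫ s in (0:ℝ)..1, fderivWithin ℝ (G t) t.U (Lseg PP s x) e0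
  let D : CD M c δ → (Fin 4 → ℝ) → ℝ := fun t x =>
    ∫ s in (0:ℝ)..1, fderivWithin ℝ (G t) t.U (Lseg PP s x) e3
  have hB : BF CD.U B := BF.int hU CD.convex PP CD.mapsPP PP_norm (hG.dir hU e0)
  have hD : BF CD.U D := BF.int hU CD.convex PP CD.mapsPP PP_norm (hG.dir hU e3)
  have hGBD : ∀ t, ∀ x ∈ t.U, G t x = B t x * (x 0 - x 1) + D t x * (x 3 - x 2) := by
    intro t x hx
    obtain ⟨p0, p1, p2, p3⟩ := PP_apply x
    have hxP : x - PP x = (x 0 - x 1) • e0 + (x 3 - x 2) • e3 := by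
      ext i
      fin_cases i <;> simp [e0, e3, p0, p1, p2, p3]
    have hcd : ContinuousOn (fun s => fderivWithin ℝ (G t) t.U (Lseg PP s x)) (Icc (0:ℝ) 1) := by
      refine ((hG.1 t).continuousOn_fderivWithin (hU t).uniqueDiffOn (by simp)).comp
        (hLc x).continuousOn (fun s hs => hL t s hs x hx)
    have hci : ∀ e, IntervalIntegrable (fun s => fderivWithin ℝ (G t) t.U (Lseg PP s x) e)
        MeasureTheory.volume 0 1 := by
      intro e
      apply ContinuousOn.intervalIntegrable
      rw [Set.uIcc_of_le zero_le_one]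
      exact hcd.clm_apply continuousOn_const
    have key := intervalIntegral.integral_eq_sub_of_hasDerivAt (a := (0:ℝ)) (b := 1)
      (f := fun s => G t (Lseg PP s x))
      (f' := fun s => fderivWithin ℝ (G t) t.U (Lseg PP s x) (x - PP x)) ?_ (hci _)
    · have hl1 : Lseg PP 1 x = x := by rw [Lseg_apply]; simp
      have hl0 : Lseg PP 0 x = PP x := by rw [Lseg_apply]; simp
      have hG0 : G t (PP x) = 0 := by
        have hPP : ∀ s, Lseg PP s (PP x) = PP x := by
          intro s
          have : PP (PP x) = PP x := by
            obtain ⟨p0', p1', p2', p3'⟩ := PP_apply (PP x)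
            ext i
            fin_cases i <;> simp [p0, p1, p2, p3, p0', p1', p2', p3']
          rw [Lseg_apply, this]; module
        have hf0 : f t (PP x) = deriv t.a (x 1) := by simp [f, hPP, p0]
        have hg0 : g t (PP x) = deriv t.a (x 2) := by simp [g, hPP, p3]
        have hh := h23 t x hx
        simp only [G, hf0, hg0, p0, p1, p2, p3]
        rw [Real.mul_self_sqrt (by linarith)]; ring
      rw [hl1, hl0, hG0, sub_zero] at key
      rw [← key, hxP]
      simp only [map_add, map_smul, smul_eq_mul]
      rw [intervalIntegral.integral_add ((hci e0).const_mul _) ((hci e3).const_mul _),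
        intervalIntegral.integral_const_mul, intervalIntegral.integral_const_mul]
      simp only [B, D]; ring
    · intro s hs
      rw [Set.uIcc_of_le zero_le_one] at hs
      have hm := hL t s hs x hx
      have h1 : HasFDerivAt (G t) (fderivWithin ℝ (G t) t.U (Lseg PP s x)) (Lseg PP s x) :=
        ((((hG.1 t) _ hm).differentiableWithinAt (by simp)).hasFDerivWithinAt).hasFDerivAt
          ((hU t).mem_nhds hm)
      have h2 : HasDerivAt (fun s : ℝ => Lseg PP s x) (x - PP x) s := by
        have e : (fun s : ℝ => Lseg PP s x) = fun s => PP x + s • (x - PP x) := by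
          funext s; simp [Lseg]
        rw [e]
        have := ((hasDerivAt_id s).smul_const (x - PP x)).const_add (PP x)
        simpa using this
      exact h1.comp_hasDerivAt s h2
  have hb : BF CD.U (fun t x => (- (D t x + B t x)) * (g t x - f t x)⁻¹) :=
    ((hD.add hU hB).neg hU).mul hU hji
  have hr : BF CD.U (fun t x => (B t x * g t x + D t x * f t x) * (g t x - f t x)⁻¹) :=
    ((hB.mul hU hg).add hU (hD.mul hU hf)).mul hU hji
  obtain ⟨hb1, Cb, hb2⟩ := hb
  obtain ⟨hr1, Cr, hr2⟩ := hr
  refine ⟨fun n => max (Cb n) (Cr n), fun t => ⟨_, _, hb1 t, hr1 t, fun x hx => ⟨?_, fun n => ?_⟩⟩⟩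
  · have hGx := hGBD t x hx
    have hj0 : g t x - f t x ≠ 0 := (hcδ.trans_le (hjc t x hx)).ne'
    have ea : t.a (x 0) - t.a (x 1) + t.a (x 2) - t.a (x 3) =
        f t x * (x 0 - x 1) - g t x * (x 3 - x 2) := by rw [hfa, hga]; ring
    rw [hfp, hgp, ea, abs_sub_comm (deriv t.a (x 0)), abs_sub_comm (deriv t.a (x 1)),
      abs_of_nonneg (hcδ.le.trans (h14 t x hx)), abs_of_nonneg (hcδ.le.trans (h23 t x hx))]
    have hGd : G t x = (g t x - f t x) - Real.sqrt (deriv t.a (x 3) - deriv t.a (x 0)) *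
      Real.sqrt (deriv t.a (x 2) - deriv t.a (x 1)) := rfl
    have e1 : - f t x - - g t x = Real.sqrt (deriv t.a (x 3) - deriv t.a (x 0)) *
      Real.sqrt (deriv t.a (x 2) - deriv t.a (x 1)) + G t x := by rw [hGd]; ring
    rw [e1, hGx]
    field_simp
    ring
  · rw [← iteratedFDerivWithin_of_isOpen n (hU t) hx, ← iteratedFDerivWithin_of_isOpen n (hU t) hx]
    exact ⟨(hb2 n t x hx).trans (le_max_left _ _), (hr2 n t x hx).trans (le_max_right _ _)⟩

lemma tail_bound (γ c₂ : ℝ) (hγ : γ < -1) (hc₂ : 0 < c₂) (a : ℝ → ℝ)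
    (ha : ContDiff ℝ (⊤ : ℕ∞) a) (hlo : ∀ ζ, 0 ≤ deriv (deriv a) ζ)
    (hhi : ∀ ζ, deriv (deriv a) ζ ≤ c₂ * (1 + ζ ^ 2) ^ (γ / 2)) (v : ℝ)
    (hv : Filter.Tendsto (deriv a) Filter.atTop (nhds (-v))) (ζ : ℝ) (hζ : 0 < ζ) :
    |deriv a ζ + v| ≤ c₂ / (-(γ + 1)) * ζ ^ (γ + 1) := by
  have hd : ContDiff ℝ (⊤ : ℕ∞) (deriv a) := (contDiff_infty_iff_deriv.1 ha).2
  have hdd : Differentiable ℝ (deriv a) := hd.differentiable (by simp)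
  have hmono : Monotone (deriv a) := monotone_of_deriv_nonneg hdd hlo
  have h1 : deriv a ζ ≤ -v := hmono.ge_of_tendsto hv ζ
  let h : ℝ → ℝ := fun x => deriv a x - c₂ / (γ + 1) * x ^ (γ + 1)
  have hg1 : γ + 1 ≠ 0 := by linarith
  have hder : ∀ x ∈ Ioi (0:ℝ), HasDerivAt h (deriv (deriv a) x - c₂ * x ^ γ) x := by
    intro x hx
    have := ((hdd x).hasDerivAt).sub
      ((Real.hasDerivAt_rpow_const (x := x) (p := γ + 1) (Or.inl (ne_of_gt hx))).const_mul
        (c₂ / (γ + 1)))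
    refine this.congr_deriv ?_
    rw [add_sub_cancel_right]
    field_simp
  have hanti : AntitoneOn h (Ioi 0) := by
    refine antitoneOn_of_deriv_nonpos (convex_Ioi 0)
      (fun x hx => (hder x hx).continuousAt.continuousWithinAt)
      (fun x hx => ((hder x (by simpa using hx)).differentiableAt).differentiableWithinAt) ?_
    intro x hx
    rw [interior_Ioi] at hx
    rw [(hder x hx).deriv]
    have hx0 : 0 < x := hx
    have e : x ^ γ = (x ^ 2) ^ (γ / 2) := by
      rw [← Real.rpow_natCast, ← Real.rpow_mul hx0.le]; congr 1; push_cast; ring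
    have h2 : (1 + x ^ 2) ^ (γ / 2) ≤ (x ^ 2) ^ (γ / 2) :=
      Real.rpow_le_rpow_of_nonpos (by positivity) (by linarith) (by linarith)
    have := hhi x
    rw [e]
    nlinarith
  have hlim : Filter.Tendsto h Filter.atTop (nhds (-v - c₂ / (γ + 1) * 0)) := by
    refine hv.sub (Filter.Tendsto.const_mul _ ?_)
    have := tendsto_rpow_neg_atTop (y := -(γ + 1)) (by linarith)
    simpa using this
  have h2 : -v - c₂ / (γ + 1) * 0 ≤ h ζ := by
    refine le_of_tendsto hlim ?_
    filter_upwards [Filter.eventually_ge_atTop ζ] with x hx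
    exact hanti hζ (hζ.trans_le hx) hx
  have h3 : c₂ / (-(γ + 1)) * ζ ^ (γ + 1) = - (c₂ / (γ + 1) * ζ ^ (γ + 1)) := by
    rw [div_neg]; ring
  rw [h3, abs_of_nonpos (by linarith)]
  simp only [h, mul_zero, sub_zero] at h2
  linarith

lemma scale_bound {V : Set (Fin 4 → ℝ)} (hV : IsOpen V) (b : (Fin 4 → ℝ) → ℝ)
    (hb : ContDiffOn ℝ (⊤ : ℕ∞) b V) (κ μ : ℝ) (hκ : 0 ≤ κ) (hμ : 0 ≤ μ) (K : ℝ) (n : ℕ)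
    (x : Fin 4 → ℝ) (hx : μ • x ∈ V) (hK : ‖iteratedFDeriv ℝ n b (μ • x)‖ ≤ K) :
    ‖iteratedFDeriv ℝ n (fun ξ => κ * b (μ • ξ)) x‖ ≤ K * (κ * μ ^ n) := by
  let g : (Fin 4 → ℝ) →L[ℝ] (Fin 4 → ℝ) := μ • ContinuousLinearMap.id ℝ _
  have hg : ‖g‖ ≤ μ := by
    refine ContinuousLinearMap.opNorm_le_bound _ hμ fun y => ?_
    simp [g, norm_smul, abs_of_nonneg hμ]
  have hgV : IsOpen (g ⁻¹' V) := hV.preimage g.continuous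
  have hn : (n : WithTop ℕ∞) ≤ (⊤ : ℕ∞) := by exact_mod_cast le_top
  have hxg : x ∈ g ⁻¹' V := hx
  have e : (fun ξ => κ * b (μ • ξ)) = κ • (b ∘ g) := by
    funext ξ; simp [g]
  have hcd : ContDiffAt ℝ n (b ∘ g) x :=
    (((hb.comp g.contDiff.contDiffOn (fun _ h => h)) : ContDiffOn ℝ (⊤ : ℕ∞) (b ∘ g)
      (g ⁻¹' V)).contDiffAt (hgV.mem_nhds hxg)).of_le hn
  rw [e, iteratedFDeriv_const_smul_apply hcd, norm_smul, Real.norm_of_nonneg hκ,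
    ← iteratedFDerivWithin_of_isOpen n hgV hxg,
    g.iteratedFDerivWithin_comp_right hb hV.uniqueDiffOn hgV.uniqueDiffOn hx hn,
    iteratedFDerivWithin_of_isOpen n hV (show g x ∈ V from hx)]
  have h1 := ContinuousMultilinearMap.norm_compContinuousLinearMap_le
    (iteratedFDeriv ℝ n b (g x)) (fun _ : Fin n => g)
  have h2 : ∏ i : Fin n, ‖g‖ ≤ μ ^ n := by
    rw [Finset.prod_const, Finset.card_univ, Fintype.card_fin]
    gcongr
  have h3 : ‖iteratedFDeriv ℝ n b (g x)‖ * ∏ i : Fin n, ‖g‖ ≤ K * μ ^ n :=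
    mul_le_mul hK h2 (Finset.prod_nonneg fun _ _ => norm_nonneg _) ((norm_nonneg _).trans hK)
  calc _ ≤ κ * (K * μ ^ n) := mul_le_mul_of_nonneg_left (h1.trans h3) hκ
    _ = _ := by ring

lemma scaled_deriv (γ v lam : ℝ) (hlam : 0 < lam) (a : ℝ → ℝ) (ha : ContDiff ℝ (⊤ : ℕ∞) a) :
    deriv (fun t => lam ^ (-γ - 2) * (a (lam * t) + v * (lam * t))) =
      fun t => lam ^ (-γ - 1) * (deriv a (lam * t) + v) := by
  funext t
  have hd : Differentiable ℝ a := ha.differentiable (by simp)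
  have hl : HasDerivAt (fun t : ℝ => lam * t) lam t := by
    simpa using (hasDerivAt_id t).const_mul lam
  have h1 := ((((hd (lam * t)).hasDerivAt.comp t hl).add (hl.const_mul v))).const_mul (lam ^ (-γ - 2))
  have h2 := h1.deriv
  refine h2.trans ?_
  have e : lam ^ (-γ - 1) = lam ^ (-γ - 2) * lam := by
    rw [← Real.rpow_add_one hlam.ne']; congr 1; ring
  rw [e]; ring

lemma scaled_deriv2 (γ v lam : ℝ) (hlam : 0 < lam) (a : ℝ → ℝ) (ha : ContDiff ℝ (⊤ : ℕ∞) a) :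
    deriv (deriv (fun t => lam ^ (-γ - 2) * (a (lam * t) + v * (lam * t)))) =
      fun t => lam ^ (-γ) * (deriv (deriv a) (lam * t)) := by
  rw [scaled_deriv γ v lam hlam a ha]
  funext t
  have hd : Differentiable ℝ (deriv a) :=
    (contDiff_infty_iff_deriv.1 ha).2.differentiable (by simp)
  have hl : HasDerivAt (fun t : ℝ => lam * t) lam t := by
    simpa using (hasDerivAt_id t).const_mul lam
  have h1 := ((((hd (lam * t)).hasDerivAt.comp t hl).add_const v)).const_mul (lam ^ (-γ - 1))
  have h2 := h1.deriv
  refine h2.trans ?_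
  have e : lam ^ (-γ) = lam ^ (-γ - 1) * lam := by
    rw [← Real.rpow_add_one hlam.ne']; congr 1; ring
  rw [e]; ring

lemma scaled_deriv_n (γ v lam : ℝ) (hlam : 0 < lam) (a : ℝ → ℝ) (ha : ContDiff ℝ (⊤ : ℕ∞) a)
    (m : ℕ) (t : ℝ) :
    iteratedDeriv (m + 1) (deriv (fun t => lam ^ (-γ - 2) * (a (lam * t) + v * (lam * t)))) t =
      lam ^ (-γ) * (lam ^ m * iteratedDeriv (m + 2) a (lam * t)) := by
  have hd : ContDiff ℝ (⊤ : ℕ∞) (deriv (deriv a)) :=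
    (contDiff_infty_iff_deriv.1 (contDiff_infty_iff_deriv.1 ha).2).2
  have hdm : ContDiff ℝ m (deriv (deriv a)) := hd.of_le (by exact_mod_cast le_top)
  rw [iteratedDeriv_succ', scaled_deriv2 γ v lam hlam a ha, iteratedDeriv_const_mul]
  · rw [iteratedDeriv_comp_const_mul hdm, iteratedDeriv_succ', iteratedDeriv_succ']
  · exact (hdm.comp (contDiff_const.mul contDiff_id)).contDiffAt

lemma psym_scaled (γ v lam : ℝ) (hlam : 0 < lam) (a : ℝ → ℝ) (ha : ContDiff ℝ (⊤ : ℕ∞) a)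
    (x y : ℝ) :
    psym (fun t => lam ^ (-γ - 2) * (a (lam * t) + v * (lam * t))) x y =
      lam ^ (-γ - 1) * (psym a (lam * x) (lam * y) - v) := by
  have e : lam ^ (-γ - 1) = lam ^ (-γ - 2) * lam := by
    rw [← Real.rpow_add_one hlam.ne']; congr 1; ring
  unfold psym
  by_cases h : x = y
  · subst h
    rw [if_pos rfl, if_pos rfl, scaled_deriv γ v lam hlam a ha]; ring
  · have h' : lam * x ≠ lam * y := fun hh => h (mul_left_cancel₀ hlam.ne' hh)
    rw [if_neg h, if_neg h', e]
    have h1 : x - y ≠ 0 := sub_ne_zero.2 h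
    have h2 : lam * x - lam * y ≠ 0 := sub_ne_zero.2 h'
    have h3 : lam * x - lam * y = lam * (x - y) := by ring
    rw [h3]
    have := hlam.ne'
    field_simp
    ring

/-- Semi-balanced interaction Morawetz division lemma, generalized Klein–Gordon case `γ < -1`
with matched (positive) frequency signs: with asymptotic velocity `v = -lim_{ζ→+∞} a'(ζ)`,
the symbol `j⁴ = p(ξ₁,ξ₂) - p(ξ₃,ξ₄)` splits on a neighborhood of `W = I×I×J×J` as
`q(ξ₁,ξ₄)q(ξ₂,ξ₃) + b_I·(Δ⁴a + vΔ⁴ξ) + r_I·Δ⁴ξ`, with `q(ζ,ζ') = |a'(ζ)-a'(ζ')|^{1/2}`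
and bounds `|∂^α b_I| ≲ λ^{-1-|α|}`, `|∂^α r_I| ≲ λ^{γ-|α|}`. -/
theorem stmt_7 (γ ρ C₀ c₁ c₂ : ℝ) (hγ : γ < -1) (hρ₁ : 0 < ρ) (hρ₂ : ρ < 1)
    (hC₀ : 1 < C₀) (hc₁ : 0 < c₁) (hc₁₂ : c₁ ≤ c₂) (Ck : ℕ → ℝ) :
    ∃ C : ℕ → ℝ,
      ∀ a : ℝ → ℝ, ContDiff ℝ (⊤ : ℕ∞) a →
      (∀ ζ : ℝ, c₁ * (1 + ζ ^ 2) ^ (γ / 2) ≤ iteratedDeriv 2 a ζ ∧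
          iteratedDeriv 2 a ζ ≤ c₂ * (1 + ζ ^ 2) ^ (γ / 2)) →
      (∀ k : ℕ, 2 ≤ k → ∀ ζ : ℝ,
          |iteratedDeriv k a ζ| ≤ Ck k * (1 + ζ ^ 2) ^ ((γ + 2 - (k : ℝ)) / 2)) →
      ∀ v : ℝ, Filter.Tendsto (deriv a) Filter.atTop (nhds (-v)) →
      ∀ lam : ℝ, 1 ≤ lam →
      ∀ i₁ i₂ j₁ j₂ : ℝ,
        lam ≤ i₁ → i₁ ≤ i₂ → i₂ ≤ C₀ * lam →
        lam ≤ j₁ → j₁ ≤ j₂ → j₂ ≤ C₀ * lam →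
        ρ * lam ≤ j₁ - i₂ →
        ∃ (U : Set (Fin 4 → ℝ)) (bI rI : (Fin 4 → ℝ) → ℝ),
          IsOpen U ∧
          {ξ : Fin 4 → ℝ | ξ 0 ∈ Icc i₁ i₂ ∧ ξ 1 ∈ Icc i₁ i₂ ∧
            ξ 2 ∈ Icc j₁ j₂ ∧ ξ 3 ∈ Icc j₁ j₂} ⊆ U ∧
          ContDiffOn ℝ (⊤ : ℕ∞) bI U ∧ ContDiffOn ℝ (⊤ : ℕ∞) rI U ∧
          ∀ ξ : Fin 4 → ℝ,
            ξ 0 ∈ Icc i₁ i₂ → ξ 1 ∈ Icc i₁ i₂ → ξ 2 ∈ Icc j₁ j₂ → ξ 3 ∈ Icc j₁ j₂ →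
            (psym a (ξ 0) (ξ 1) - psym a (ξ 2) (ξ 3) =
                Real.sqrt |deriv a (ξ 0) - deriv a (ξ 3)| *
                  Real.sqrt |deriv a (ξ 1) - deriv a (ξ 2)| +
                bI ξ * ((a (ξ 0) - a (ξ 1) + a (ξ 2) - a (ξ 3))
                  + v * (ξ 0 - ξ 1 + ξ 2 - ξ 3)) +
                rI ξ * (ξ 0 - ξ 1 + ξ 2 - ξ 3)) ∧
            ∀ n : ℕ,
              ‖iteratedFDeriv ℝ n bI ξ‖ ≤ C n * lam ^ (-1 - (n : ℝ)) ∧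
              ‖iteratedFDeriv ℝ n rI ξ‖ ≤ C n * lam ^ (γ - (n : ℝ)) := by
  have hc₂ : 0 < c₂ := hc₁.trans_le hc₁₂
  obtain ⟨C, hC⟩ := core
    (fun n => if n = 0 then c₂ / (-(γ + 1)) * (1 / 2 : ℝ) ^ (γ + 1)
      else |Ck (n + 1)| * (1 / 4 : ℝ) ^ ((γ + 1 - (n : ℝ)) / 2))
    (c₁ * (1 + (C₀ + 1) ^ 2) ^ (γ / 2)) (ρ / 2) (by positivity) (by positivity)
  refine ⟨C, ?_⟩
  intro a ha h2 hk v hv lam hlam i₁ i₂ j₁ j₂ hi1 hi12 hi2 hj1 hj12 hj2 hsep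
  have hl0 : 0 < lam := by linarith
  have h2' : ∀ ζ, iteratedDeriv 2 a ζ = deriv (deriv a) ζ := by
    intro ζ; rw [iteratedDeriv_succ', iteratedDeriv_one]
  have hA1 : 1 ≤ i₁ / lam := by rw [le_div_iff₀ hl0]; linarith
  have hA2 : j₂ / lam ≤ C₀ := by rw [div_le_iff₀ hl0]; linarith
  have hA3 : ρ ≤ j₁ / lam - i₂ / lam := by rw [← sub_div, le_div_iff₀ hl0]; linarith
  -- membership in the rescaled window
  have hwin : ∀ x ∈ Ioo (i₁ / lam - ρ / 4) (j₂ / lam + ρ / 4), 1 / 2 ≤ x ∧ x ≤ C₀ + 1 := by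
    intro x hx
    exact ⟨by linarith [hx.1], by linarith [hx.2]⟩
  have hpow : ∀ e : ℝ, lam ^ e = (lam ^ 2) ^ (e / 2) := by
    intro e
    rw [← Real.rpow_natCast, ← Real.rpow_mul hl0.le]; congr 1; push_cast; ring
  let t : CD (fun n => if n = 0 then c₂ / (-(γ + 1)) * (1 / 2 : ℝ) ^ (γ + 1)
      else |Ck (n + 1)| * (1 / 4 : ℝ) ^ ((γ + 1 - (n : ℝ)) / 2))
      (c₁ * (1 + (C₀ + 1) ^ 2) ^ (γ / 2)) (ρ / 2) :=
    { a := fun t => lam ^ (-γ - 2) * (a (lam * t) + v * (lam * t))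
      i1 := i₁ / lam - ρ / 4
      i2 := i₂ / lam + ρ / 4
      j1 := j₁ / lam - ρ / 4
      j2 := j₂ / lam + ρ / 4
      ha := by
        have hl : ContDiff ℝ (⊤ : ℕ∞) (fun t : ℝ => lam * t) := contDiff_const.mul contDiff_id
        exact contDiff_const.mul ((ha.comp hl).add (contDiff_const.mul hl))
      hM := by
        intro n x hx
        obtain ⟨hx1, hx2⟩ := hwin x hx
        rcases n with _ | m
        · rw [if_pos rfl, iteratedDeriv_zero, scaled_deriv γ v lam hl0 a ha]
          have hz : 0 < lam * x := by positivity
          have h1 := tail_bound γ c₂ hγ hc₂ a ha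
            (fun ζ => by
              rw [← h2']; refine le_trans ?_ (h2 ζ).1; positivity)
            (fun ζ => by rw [← h2']; exact (h2 ζ).2) v hv (lam * x) hz
          have h3 : (lam * x) ^ (γ + 1) ≤ (lam * (1 / 2)) ^ (γ + 1) :=
            Real.rpow_le_rpow_of_nonpos (by positivity) (by gcongr) (by linarith)
          rw [Real.mul_rpow (x := lam) (y := 1 / 2) hl0.le (by norm_num)] at h3
          have h4 : 0 ≤ c₂ / (-(γ + 1)) := div_nonneg hc₂.le (by linarith)
          have h5 : 0 < lam ^ (-γ - 1) := Real.rpow_pos_of_pos hl0 _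
          have h6 : lam ^ (-γ - 1) * lam ^ (γ + 1) = 1 := by
            rw [← Real.rpow_add hl0]; ring_nf; exact Real.rpow_zero _
          rw [abs_mul, abs_of_pos h5]
          calc lam ^ (-γ - 1) * |deriv a (lam * x) + v|
              ≤ lam ^ (-γ - 1) * (c₂ / (-(γ + 1)) * (lam ^ (γ + 1) * (1 / 2) ^ (γ + 1))) := by
                gcongr
                exact h1.trans (mul_le_mul_of_nonneg_left h3 h4)
            _ = (lam ^ (-γ - 1) * lam ^ (γ + 1)) * (c₂ / (-(γ + 1)) * (1 / 2) ^ (γ + 1)) := by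
                ring
            _ = _ := by rw [h6, one_mul]
        · rw [if_neg (Nat.succ_ne_zero m), scaled_deriv_n γ v lam hl0 a ha]
          have h1 := hk (m + 2) (by omega) (lam * x)
          have he : (γ + 2 - ((m + 2 : ℕ) : ℝ)) / 2 = (γ - m) / 2 := by push_cast; ring
          have he' : (γ + 1 - ((m + 1 : ℕ) : ℝ)) / 2 = (γ - m) / 2 := by push_cast; ring
          rw [he] at h1
          rw [he']
          have hm0 : (0:ℝ) ≤ m := Nat.cast_nonneg m
          have h3 : (1 + (lam * x) ^ 2) ^ ((γ - m) / 2) ≤ (lam ^ 2 * (1 / 4)) ^ ((γ - m) / 2) := by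
            refine Real.rpow_le_rpow_of_nonpos (by positivity) ?_ (by linarith)
            have : lam * (1 / 2) ≤ lam * x := by gcongr
            nlinarith
          rw [Real.mul_rpow (by positivity) (by norm_num), ← hpow] at h3
          have h5 : 0 < lam ^ (-γ) := Real.rpow_pos_of_pos hl0 _
          have h6 : lam ^ (-γ) * (lam ^ m * lam ^ (γ - m)) = 1 := by
            rw [← Real.rpow_natCast, ← Real.rpow_add hl0, ← Real.rpow_add hl0]
            ring_nf; exact Real.rpow_zero _
          rw [abs_mul, abs_mul, abs_of_pos h5, abs_of_pos (pow_pos hl0 m)]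
          have h7 : |iteratedDeriv (m + 2) a (lam * x)| ≤
              |Ck (m + 2)| * (lam ^ (γ - m) * (1 / 4) ^ ((γ - m) / 2)) := by
            refine h1.trans ?_
            refine mul_le_mul (le_abs_self _) h3 (by positivity) (abs_nonneg _)
          calc _ ≤ lam ^ (-γ) * (lam ^ m *
                (|Ck (m + 2)| * (lam ^ (γ - m) * (1 / 4) ^ ((γ - m) / 2)))) := by gcongr
            _ = (lam ^ (-γ) * (lam ^ m * lam ^ (γ - m))) *
                (|Ck (m + 2)| * (1 / 4) ^ ((γ - m) / 2)) := by ring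
            _ = _ := by rw [h6, one_mul]
      hc := by
        intro x hx
        obtain ⟨hx1, hx2⟩ := hwin x hx
        rw [scaled_deriv2 γ v lam hl0 a ha]
        have h1 := (h2 (lam * x)).1
        rw [h2'] at h1
        have h3 : (lam ^ 2 * (1 + (C₀ + 1) ^ 2)) ^ (γ / 2) ≤ (1 + (lam * x) ^ 2) ^ (γ / 2) := by
          refine Real.rpow_le_rpow_of_nonpos (by positivity) ?_ (by linarith)
          have e1 : x ^ 2 ≤ (C₀ + 1) ^ 2 := by gcongr
          have e2 : (1:ℝ) ≤ lam ^ 2 := one_le_pow₀ hlam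
          nlinarith
        rw [Real.mul_rpow (by positivity) (by positivity), ← hpow] at h3
        have h5 : 0 < lam ^ (-γ) := Real.rpow_pos_of_pos hl0 _
        have h6 : lam ^ (-γ) * lam ^ γ = 1 := by
          rw [← Real.rpow_add hl0]; simp
        calc c₁ * (1 + (C₀ + 1) ^ 2) ^ (γ / 2)
            = lam ^ (-γ) * (c₁ * (lam ^ γ * (1 + (C₀ + 1) ^ 2) ^ (γ / 2))) := by
              rw [show ∀ p q r s : ℝ, p * (q * (r * s)) = (p * r) * (q * s) by
                intros; ring, h6, one_mul]
          _ ≤ lam ^ (-γ) * (c₁ * (1 + (lam * x) ^ 2) ^ (γ / 2)) := by gcongr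
          _ ≤ _ := mul_le_mul_of_nonneg_left h1 h5.le
      hsep := by linarith }
  obtain ⟨b, r, hb, hr, hbr⟩ := hC t
  have hlin : ContDiff ℝ (⊤ : ℕ∞) (fun ξ : Fin 4 → ℝ => lam⁻¹ • ξ) :=
    contDiff_id.const_smul lam⁻¹
  have hmem : ∀ ξ : Fin 4 → ℝ, ξ 0 ∈ Icc i₁ i₂ → ξ 1 ∈ Icc i₁ i₂ → ξ 2 ∈ Icc j₁ j₂ →
      ξ 3 ∈ Icc j₁ j₂ → lam⁻¹ • ξ ∈ t.U := by
    intro ξ h0 h1 h2 h3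
    have hh : ∀ (i : Fin 4) (p q : ℝ), ξ i ∈ Icc p q →
        (lam⁻¹ • ξ) i ∈ Ioo (p / lam - ρ / 4) (q / lam + ρ / 4) := by
      intro i p q hi
      have e : (lam⁻¹ • ξ) i = ξ i / lam := by
        rw [Pi.smul_apply, smul_eq_mul, div_eq_inv_mul]
      rw [e]
      have e1 : p / lam ≤ ξ i / lam := div_le_div_of_nonneg_right hi.1 hl0.le
      have e2 : ξ i / lam ≤ q / lam := div_le_div_of_nonneg_right hi.2 hl0.le
      exact ⟨by linarith, by linarith⟩
    exact ⟨hh 0 _ _ h0, hh 1 _ _ h1, hh 2 _ _ h2, hh 3 _ _ h3⟩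
  refine ⟨(fun ξ => lam⁻¹ • ξ) ⁻¹' t.U, fun ξ => lam⁻¹ * b (lam⁻¹ • ξ),
    fun ξ => lam ^ γ * r (lam⁻¹ • ξ), t.isOpen.preimage hlin.continuous, ?_, ?_, ?_, ?_⟩
  · rintro ξ ⟨h0, h1, h2, h3⟩
    exact hmem ξ h0 h1 h2 h3
  · exact contDiffOn_const.mul (hb.comp hlin.contDiffOn (fun _ h => h))
  · exact contDiffOn_const.mul (hr.comp hlin.contDiffOn (fun _ h => h))
  · intro ξ h0 h1 h2 h3
    have hξ := hmem ξ h0 h1 h2 h3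
    obtain ⟨hid, hbd⟩ := hbr _ hξ
    refine ⟨?_, fun n => ⟨?_, ?_⟩⟩
    · have hli : ∀ i : Fin 4, lam * (lam⁻¹ • ξ) i = ξ i := by
        intro i; rw [Pi.smul_apply, smul_eq_mul, mul_inv_cancel_left₀ hl0.ne']
      have hta : t.a = fun t => lam ^ (-γ - 2) * (a (lam * t) + v * (lam * t)) := rfl
      rw [hta, psym_scaled γ v lam hl0 a ha, psym_scaled γ v lam hl0 a ha,
        scaled_deriv γ v lam hl0 a ha] at hid
      simp only [hli] at hid
      simp only [Pi.smul_apply, smul_eq_mul] at hid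
      have h5 : 0 < lam ^ (-γ - 1) := Real.rpow_pos_of_pos hl0 _
      have hs : ∀ z w : ℝ, lam ^ (-γ - 1) * (z + v) - lam ^ (-γ - 1) * (w + v) =
          lam ^ (-γ - 1) * (z - w) := fun z w => by ring
      rw [hs, hs, abs_mul, abs_mul, abs_of_pos h5, Real.sqrt_mul h5.le, Real.sqrt_mul h5.le] at hid
      have hss := Real.mul_self_sqrt h5.le
      have e2 : lam ^ (-γ - 2) = lam ^ (-γ - 1) * lam⁻¹ := by
        rw [← Real.rpow_neg_one lam, ← Real.rpow_add hl0]; congr 1; ring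
      have e3 : lam⁻¹ = lam ^ (-γ - 1) * lam ^ γ := by
        rw [← Real.rpow_neg_one lam, ← Real.rpow_add hl0]; congr 1; ring
      have e4 : lam⁻¹ * ξ 0 - lam⁻¹ * ξ 1 + lam⁻¹ * ξ 2 - lam⁻¹ * ξ 3 =
        lam ^ (-γ - 1) * lam ^ γ * (ξ 0 - ξ 1 + ξ 2 - ξ 3) := by rw [← e3]; ring
      rw [e2, e4] at hid
      apply mul_left_cancel₀ h5.ne'
      linear_combination hid + √|deriv a (ξ 0) - deriv a (ξ 3)| *
        √|deriv a (ξ 1) - deriv a (ξ 2)| * hss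
    · have := scale_bound t.isOpen b hb lam⁻¹ lam⁻¹ (by positivity) (by positivity) (C n) n ξ hξ
        (hbd n).1
      refine this.trans (le_of_eq ?_)
      congr 1
      rw [sub_eq_add_neg, Real.rpow_add hl0, Real.rpow_neg_one, Real.rpow_neg hl0.le,
        Real.rpow_natCast, inv_pow]
    · have := scale_bound t.isOpen r hr (lam ^ γ) lam⁻¹ (by positivity) (by positivity) (C n) n ξ hξ
        (hbd n).2
      refine this.trans (le_of_eq ?_)
      congr 1
      rw [sub_eq_add_neg, Real.rpow_add hl0, Real.rpow_neg hl0.le, Real.rpow_natCast, inv_pow]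
end

section
/- Let u, v be Schwartz functions on ℝ whose Fourier transforms û, v̂ have compact supports K₁ := supp û and K₂ := supp v̂. Let q : ℝ² → ℝ be smooth and positive on an open neighborhood of K₁ × K₂. Define, for Schwartz functions f, g, the translation-invariant bilinear form Q(f, ḡ)(x) := (2π)^{-2} ∬ e^{ix(ξ-η)} q(ξ,η) f̂(ξ) conj(ĝ(η)) dξ dη. Then there exists a Schwartz function K₀ : ℝ² → ℂ such that for every x ∈ ℝ: u(x) conj(v(x)) = ∬_{ℝ²} K₀(x₀, y₀) Q(u(· + x₀), conj(v(· + y₀)))(x) dx₀ dy₀. -/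
open MeasureTheory Set

/-- Fourier transform with the convention `f̂(ξ) = ∫ e^{-ixξ} f(x) dx`. -/
noncomputable def FT (f : ℝ → ℂ) (ξ : ℝ) : ℂ :=
  ∫ x : ℝ, Complex.exp (-(Complex.I * (x : ℂ) * (ξ : ℂ))) * f x

/-- The translation-invariant bilinear form with symbol `q`:
`Q(f, ḡ)(x) = (2π)^{-2} ∬ e^{ix(ξ-η)} q(ξ,η) f̂(ξ) conj(ĝ(η)) dξ dη`. -/
noncomputable def Qform (q : ℝ × ℝ → ℝ) (f g : ℝ → ℂ) (x : ℝ) : ℂ :=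
  (((2 * Real.pi) ^ 2 : ℝ) : ℂ)⁻¹ *
    ∫ ξ : ℝ, ∫ η : ℝ,
      Complex.exp (Complex.I * (x : ℂ) * ((ξ : ℂ) - (η : ℂ))) * (q (ξ, η) : ℂ) *
        FT f ξ * (starRingEnd ℂ) (FT g η)

open FourierTransform in
lemma FT_eq (u : SchwartzMap ℝ ℂ) (ξ : ℝ) :
    FT (⇑u) ξ = (𝓕 u : SchwartzMap ℝ ℂ) (ξ / (2 * Real.pi)) := by
  rw [SchwartzMap.fourier_coe, Real.fourier_real_eq_integral_exp_smul, FT]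
  refine integral_congr_ae (Filter.Eventually.of_forall fun x => ?_)
  have hpi : (Real.pi : ℂ) ≠ 0 := by exact_mod_cast Real.pi_ne_zero
  simp only [smul_eq_mul]
  congr 2
  push_cast
  field_simp

lemma FT_continuous (u : SchwartzMap ℝ ℂ) : Continuous (FT ⇑u) := by
  have : FT ⇑u = fun ξ => FT ⇑u ξ := rfl
  rw [this]
  simp_rw [FT_eq]
  exact (SchwartzMap.continuous _).comp (continuous_id.div_const _)

lemma FT_translate (u : ℝ → ℂ) (a ξ : ℝ) :
    FT (fun y => u (y + a)) ξ = Complex.exp (Complex.I * a * ξ) * FT u ξ := by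
  unfold FT
  rw [← integral_const_mul, ← integral_add_right_eq_self _ a]
  conv_rhs => rw [← integral_add_right_eq_self _ a]
  rw [integral_add_right_eq_self (fun x : ℝ => Complex.exp (-(Complex.I * (x : ℂ) * (ξ : ℂ))) * u (x + a)) a]
  refine integral_congr_ae (Filter.Eventually.of_forall fun x => ?_)
  simp only
  rw [← mul_assoc, ← Complex.exp_add]
  congr 2
  push_cast
  ring

open FourierTransform in
lemma FT_inv (u : SchwartzMap ℝ ℂ) (x : ℝ) :
    ∫ ξ : ℝ, Complex.exp (Complex.I * x * ξ) * FT (⇑u) ξ = (2 * Real.pi : ℝ) * u x := by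
  have h : u x = (𝓕⁻ (𝓕 u : SchwartzMap ℝ ℂ) : SchwartzMap ℝ ℂ) x := by simp
  have hpi : (Real.pi : ℂ) ≠ 0 := by exact_mod_cast Real.pi_ne_zero
  rw [h, SchwartzMap.fourierInv_coe, Real.fourierInv_eq']
  have := Measure.integral_comp_div (fun w : ℝ => Complex.exp (2 * Real.pi * w * x * Complex.I) *
    (𝓕 u : SchwartzMap ℝ ℂ) w) (2 * Real.pi)
  rw [abs_of_pos (by positivity), Complex.real_smul] at this
  convert this using 1
  · refine integral_congr_ae (Filter.Eventually.of_forall fun ξ => ?_)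
    simp only [FT_eq]
    congr 2
    push_cast
    field_simp
  · congr 1
    refine integral_congr_ae (Filter.Eventually.of_forall fun ξ => ?_)
    simp only [smul_eq_mul]
    congr 2
    simp
    ring

/-- Every smooth compactly supported symbol is the (adapted) Fourier transform of a Schwartz
kernel. -/
lemma exists_kernel (m : ℝ × ℝ → ℂ) (hm : ContDiff ℝ (⊤ : ℕ∞) m) (hc : HasCompactSupport m) :
    ∃ K : SchwartzMap (ℝ × ℝ) ℂ, ∀ ξ η : ℝ,
      ∫ p : ℝ × ℝ, K p * Complex.exp (Complex.I * ((p.1 : ℂ) * ξ - p.2 * η)) = m (ξ, η) := by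
  have hpi : (Real.pi : ℂ) ≠ 0 := by exact_mod_cast Real.pi_ne_zero
  have hpr : (2 * Real.pi : ℝ) ≠ 0 := by positivity
  let a : ℝˣ := Units.mk0 (2 * Real.pi) hpr
  let e : WithLp 2 (ℝ × ℝ) ≃L[ℝ] ℝ × ℝ := WithLp.prodContinuousLinearEquiv 2 ℝ ℝ ℝ
  let s : (ℝ × ℝ) ≃L[ℝ] ℝ × ℝ :=
    (ContinuousLinearEquiv.unitsEquivAut ℝ a).prodCongr (ContinuousLinearEquiv.unitsEquivAut ℝ (-a))
  let m0 : SchwartzMap (ℝ × ℝ) ℂ := hc.toSchwartzMap hm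
  let M : SchwartzMap (WithLp 2 (ℝ × ℝ)) ℂ :=
    SchwartzMap.compCLMOfContinuousLinearEquiv ℂ (e.trans s) m0
  let G : SchwartzMap (WithLp 2 (ℝ × ℝ)) ℂ := FourierTransform.fourier M
  refine ⟨SchwartzMap.compCLMOfContinuousLinearEquiv ℂ e.symm G, fun ξ η => ?_⟩
  have h1 : FourierTransformInv.fourierInv G = M := by simp [G]
  have h2 : M (WithLp.toLp 2 (ξ / (2 * Real.pi), -η / (2 * Real.pi))) = m (ξ, η) := by
    change m _ = _
    congr 1
    have hr := Real.pi_ne_zero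
    ext
    · simp [s, e, a]
    · simp [s, e, a]
  rw [← h2, ← h1, SchwartzMap.fourierInv_coe, Real.fourierInv_eq']
  rw [← (WithLp.volume_preserving_toLp ℝ ℝ).integral_comp
    (MeasurableEquiv.toLp 2 (ℝ × ℝ)).measurableEmbedding]
  refine integral_congr_ae (Filter.Eventually.of_forall fun p => ?_)
  simp only [smul_eq_mul]
  rw [mul_comm]
  congr 1
  congr 1
  simp [WithLp.prod_inner_apply]
  field_simp
  ring

/-- Smooth compactly supported cutoff of `1/q`. -/
lemma exists_symbol (q : ℝ × ℝ → ℝ) (U K : Set (ℝ × ℝ)) (hU : IsOpen U) (hK : IsCompact K)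
    (hKU : K ⊆ U) (hq : ContDiffOn ℝ (⊤ : ℕ∞) q U) (hqpos : ∀ z ∈ U, 0 < q z) :
    ∃ m : ℝ × ℝ → ℂ, ContDiff ℝ (⊤ : ℕ∞) m ∧ HasCompactSupport m ∧
      ∀ z ∈ K, (q z : ℂ) * m z = 1 := by
  obtain ⟨L, hL, hKL, hLU⟩ := exists_compact_between hK hU hKU
  obtain ⟨f, hf0, hf1, -⟩ := exists_contMDiffMap_zero_one_of_isClosed (n := (⊤ : ℕ∞))
    (modelWithCornersSelf ℝ (ℝ × ℝ)) (s := (interior L)ᶜ) (t := K)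
    isOpen_interior.isClosed_compl hK.isClosed
    (Set.disjoint_left.2 fun z hz hz' => hz (hKL hz'))
  have hf : ContDiff ℝ (⊤ : ℕ∞) (f : ℝ × ℝ → ℝ) := f.contMDiff.contDiff
  have hz : ∀ z, z ∉ L → f z = 0 := fun z hz => hf0 (fun h => hz (interior_subset h))
  have hg : ContDiff ℝ (⊤ : ℕ∞) (fun z => f z / q z) := by
    rw [contDiff_iff_contDiffAt]
    intro z
    by_cases h : z ∈ U
    · exact hf.contDiffAt.div (hq.contDiffAt (hU.mem_nhds h)) (hqpos z h).ne'
    · have hzL : z ∉ L := fun h' => h (hLU h')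
      refine (contDiffAt_const (c := (0 : ℝ))).congr_of_eventuallyEq ?_
      filter_upwards [hL.isClosed.isOpen_compl.mem_nhds hzL] with w hw
      simp [hz w hw]
  refine ⟨fun z => ((f z / q z : ℝ) : ℂ), Complex.ofRealCLM.contDiff.comp hg, ?_, ?_⟩
  · refine HasCompactSupport.intro hL fun z h => ?_
    simp [hz z h]
  · intro z h
    have h1 : f z = 1 := hf1 h
    have h2 := (hqpos z (hKU h)).ne'
    beta_reduce
    rw [h1, ← Complex.ofReal_mul, mul_one_div_cancel h2, Complex.ofReal_one]

/-- Inversion lemma: if `q` is smooth and positive near the (compact) Fourier supports of the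
Schwartz functions `u`, `v`, then the plain bilinear density `u v̄` can be recovered from
translates of the elliptic bilinear form `Q` through a Schwartz kernel `K₀`. -/
theorem stmt_8 (u v : SchwartzMap ℝ ℂ)
    (hu : HasCompactSupport (FT ⇑u)) (hv : HasCompactSupport (FT ⇑v))
    (q : ℝ × ℝ → ℝ) (U : Set (ℝ × ℝ)) (hU : IsOpen U)
    (hUsupp : (tsupport (FT ⇑u)) ×ˢ (tsupport (FT ⇑v)) ⊆ U)
    (hq : ContDiffOn ℝ (⊤ : ℕ∞) q U) (hqpos : ∀ z ∈ U, 0 < q z) :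
    ∃ K₀ : SchwartzMap (ℝ × ℝ) ℂ,
      ∀ x : ℝ,
        u x * (starRingEnd ℂ) (v x) =
          ∫ p : ℝ × ℝ,
            K₀ p * Qform q (fun y => u (y + p.1)) (fun y => v (y + p.2)) x := by
  obtain ⟨m, hm, hmc, hqm⟩ := exists_symbol q U _ hU (hu.isCompact.prod hv.isCompact) hUsupp hq hqpos
  obtain ⟨K, hK⟩ := exists_kernel m hm hmc
  refine ⟨K, fun x => ?_⟩
  have hpi : (Real.pi : ℂ) ≠ 0 := by exact_mod_cast Real.pi_ne_zero
  have hFu := FT_continuous u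
  have hFv := FT_continuous v
  let A : ℝ × ℝ → ℂ := fun z => Complex.exp (Complex.I * (x : ℂ) * ((z.1 : ℂ) - (z.2 : ℂ))) *
    (q z : ℂ) * FT (⇑u) z.1 * (starRingEnd ℂ) (FT (⇑v) z.2)
  have hA : Integrable A := by
    have hs : Function.support A ⊆ (tsupport (FT ⇑u)) ×ˢ (tsupport (FT ⇑v)) := by
      intro z hz
      constructor
      · refine subset_tsupport _ fun h => hz ?_
        simp [A, h]
      · refine subset_tsupport _ fun h => hz ?_
        simp [A, h]
    rw [← integrableOn_iff_integrable_of_support_subset hs]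
    refine ContinuousOn.integrableOn_compact (hu.isCompact.prod hv.isCompact) ?_
    have hqc : ContinuousOn (fun z => (q z : ℂ)) ((tsupport (FT ⇑u)) ×ˢ (tsupport (FT ⇑v))) :=
      Complex.continuous_ofReal.comp_continuousOn (hq.continuousOn.mono hUsupp)
    have h1 : Continuous fun z : ℝ × ℝ =>
      Complex.exp (Complex.I * (x : ℂ) * ((z.1 : ℂ) - (z.2 : ℂ))) := by fun_prop
    have h2 : Continuous fun z : ℝ × ℝ => FT (⇑u) z.1 := hFu.comp continuous_fst
    have h3 : Continuous fun z : ℝ × ℝ => (starRingEnd ℂ) (FT (⇑v) z.2) :=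
      Complex.continuous_conj.comp (hFv.comp continuous_snd)
    exact ((h1.continuousOn.mul hqc).mul h2.continuousOn).mul h3.continuousOn
  let E : ℝ × ℝ → ℝ × ℝ → ℂ := fun p z =>
    Complex.exp (Complex.I * ((p.1 : ℂ) * z.1 - p.2 * z.2))
  have hEn : ∀ p z, ‖E p z‖ = 1 := by
    intro p z
    have : Complex.I * ((p.1 : ℂ) * z.1 - p.2 * z.2)
      = ((p.1 * z.1 - p.2 * z.2 : ℝ) : ℂ) * Complex.I := by push_cast; ring
    simp only [E, this, Complex.norm_exp_ofReal_mul_I]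
  have hEA : ∀ p, Integrable fun z => A z * E p z := by
    intro p
    refine hA.mul_bdd (c := 1) ?_ (Filter.Eventually.of_forall fun z => (hEn p z).le)
    exact Continuous.aestronglyMeasurable (by fun_prop)
  have hQ : ∀ p : ℝ × ℝ, Qform q (fun y => u (y + p.1)) (fun y => v (y + p.2)) x =
      (((2 * Real.pi) ^ 2 : ℝ) : ℂ)⁻¹ * ∫ z : ℝ × ℝ, A z * E p z := by
    intro p
    rw [Qform, Measure.volume_eq_prod, integral_prod _ (hEA p)]
    congr 1
    refine integral_congr_ae (Filter.Eventually.of_forall fun ξ => ?_)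
    refine integral_congr_ae (Filter.Eventually.of_forall fun η => ?_)
    simp only [A, E, FT_translate, map_mul, ← Complex.exp_conj, Complex.conj_I, Complex.conj_ofReal]
    rw [show Complex.I * ((p.1 : ℂ) * ξ - p.2 * η) = Complex.I * p.1 * ξ + -Complex.I * p.2 * η
      by ring, Complex.exp_add]
    ring
  have hF : Integrable (Function.uncurry fun (p z : ℝ × ℝ) => K p * (A z * E p z))
      (volume.prod volume) := by
    have h0 := (K.integrable (μ := volume)).mul_prod hA
    have := h0.mul_bdd (c := 1) (g := fun w : (ℝ × ℝ) × (ℝ × ℝ) => E w.1 w.2)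
      (Continuous.aestronglyMeasurable (by fun_prop))
      (Filter.Eventually.of_forall fun z => (hEn z.1 z.2).le)
    refine this.congr (Filter.Eventually.of_forall fun w => ?_)
    simp only [Function.uncurry]
    ring
  have key : ∀ z : ℝ × ℝ, A z * m z = (Complex.exp (Complex.I * x * z.1) * FT (⇑u) z.1) *
      (starRingEnd ℂ) (Complex.exp (Complex.I * x * z.2) * FT (⇑v) z.2) := by
    intro z
    have hexp : Complex.exp (Complex.I * (x : ℂ) * ((z.1 : ℂ) - (z.2 : ℂ))) =
        Complex.exp (Complex.I * x * z.1) * (starRingEnd ℂ) (Complex.exp (Complex.I * x * z.2)) := by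
      rw [← Complex.exp_conj, ← Complex.exp_add]
      congr 1
      simp
      ring
    by_cases h1 : FT (⇑u) z.1 = 0
    · simp [A, h1]
    by_cases h2 : FT (⇑v) z.2 = 0
    · simp [A, h2]
    have h3 := hqm z ⟨subset_tsupport _ h1, subset_tsupport _ h2⟩
    simp only [A, hexp, map_mul]
    linear_combination (Complex.exp (Complex.I * x * z.1) *
      (starRingEnd ℂ) (Complex.exp (Complex.I * x * z.2)) * FT (⇑u) z.1 *
      (starRingEnd ℂ) (FT (⇑v) z.2)) * h3
  have hmain : ∫ p : ℝ × ℝ, K p * ∫ z : ℝ × ℝ, A z * E p z =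
      ((2 * Real.pi : ℝ) * u x) * (starRingEnd ℂ) ((2 * Real.pi : ℝ) * v x) := by
    simp_rw [← integral_const_mul]
    rw [integral_integral_swap hF]
    have : ∀ z : ℝ × ℝ, ∫ p : ℝ × ℝ, K p * (A z * E p z) = A z * m z := by
      intro z
      rw [← hK z.1 z.2, ← integral_const_mul]
      refine integral_congr_ae (Filter.Eventually.of_forall fun p => ?_)
      simp only [E]
      ring
    simp_rw [this, key]
    rw [Measure.volume_eq_prod, integral_prod_mul (fun ξ : ℝ => Complex.exp (Complex.I * x * ξ) * FT (⇑u) ξ)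
      (fun η : ℝ => (starRingEnd ℂ) (Complex.exp (Complex.I * x * η) * FT (⇑v) η)),
      integral_conj, FT_inv, FT_inv]
  simp_rw [hQ]
  have : ∀ p : ℝ × ℝ, K p * ((((2 * Real.pi) ^ 2 : ℝ) : ℂ)⁻¹ * ∫ z : ℝ × ℝ, A z * E p z) =
      (((2 * Real.pi) ^ 2 : ℝ) : ℂ)⁻¹ * (K p * ∫ z : ℝ × ℝ, A z * E p z) := fun p => by ring
  simp_rw [this]
  rw [integral_const_mul, hmain, map_mul, Complex.conj_ofReal]
  push_cast
  field_simp
end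

section
/- Let h : ℝ² → ℂ be smooth and symmetric, i.e. h(ξ, η) = h(η, ξ) for all ξ, η ∈ ℝ, and suppose h vanishes to second order on the diagonal: h(ξ,ξ) = 0 and (∂₁h)(ξ,ξ) = (∂₂h)(ξ,ξ) = 0 for every ξ ∈ ℝ. Then there exists a smooth function g : ℝ² → ℂ such that h(ξ, η) = (ξ - η)² · g(ξ + η, (ξ - η)²) for all (ξ, η) ∈ ℝ². -/
open Filter Topology in
theorem aux_series : ∃ C : ℝ → ℝ, ContDiff ℝ (⊤ : ℕ∞) C ∧ ∀ x : ℝ, x^2 * C (x^2) = Real.cos x - 1 := by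
  let c : ℕ → ℝ := fun n => (-1)^(n+1) / ((2*(n+1)).factorial : ℝ)
  have hr : (FormalMultilinearSeries.ofScalars ℝ c).radius = ⊤ := by
    apply FormalMultilinearSeries.ofScalars_radius_eq_top_of_tendsto
    · refine Eventually.of_forall fun n => ?_
      simp only [c]; positivity
    · have : ∀ n : ℕ, ‖c n.succ‖ / ‖c n‖ = 1 / ((2*(n:ℝ)+3) * (2*n+4)) := by
        intro n
        have e : ((2*(n+1+1)).factorial : ℝ) = (2*n+4) * ((2*n+3) * ((2*(n+1)).factorial : ℝ)) := by
          rw [show 2*(n+1+1) = (2*(n+1)+1)+1 by ring, Nat.factorial_succ, Nat.factorial_succ]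
          push_cast; ring
        simp only [c, norm_div, norm_pow, norm_neg, norm_one, one_pow, Nat.succ_eq_add_one, Real.norm_natCast]
        rw [e]
        field_simp
      simp only [this]
      refine squeeze_zero (fun n => by positivity) (fun n => ?_) tendsto_one_div_add_atTop_nhds_zero_nat
      apply one_div_le_one_div_of_le (by positivity)
      have : (0:ℝ) ≤ n := n.cast_nonneg
      nlinarith
  have hps := (FormalMultilinearSeries.ofScalars ℝ c).hasFPowerSeriesOnBall (by rw [hr]; simp)
  rw [hr] at hps
  refine ⟨(FormalMultilinearSeries.ofScalars ℝ c).sum, ?_, fun x => ?_⟩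
  · rw [contDiff_iff_contDiffAt]
    intro x
    exact (hps.analyticAt_of_mem (by simp)).contDiffAt
  · have h1 : HasSum (fun n => c n * (x^2)^n) ((FormalMultilinearSeries.ofScalars ℝ c).sum (x^2)) := by
      have := hps.hasSum (y := x^2) (by simp)
      simpa [FormalMultilinearSeries.ofScalars_apply_eq, mul_comm] using this
    have h2 := (hasSum_nat_add_iff' 1).2 (Real.hasSum_cos x)
    simp at h2
    refine (h1.mul_left (x^2)).unique ?_
    convert! h2 using 2 with n
    simp only [c]; ring

theorem aux_iter {C : ℝ → ℝ} (h : ContDiff ℝ (⊤ : ℕ∞) C) (k : ℕ) (s : ℝ) :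
    HasDerivAt (iteratedDeriv k C) (iteratedDeriv (k+1) C s) s := by
  rw [iteratedDeriv_succ]
  exact (h.differentiable_iteratedDeriv k (by exact_mod_cast ENat.natCast_lt_top k) s).hasDerivAt

open Filter Topology in
theorem aux_kernel : ∃ E : ℕ → ℝ → ℝ, (∀ k s, HasDerivAt (E k) (E (k+1) s) s) ∧
    (∀ k, ∃ M, ∀ s, |E k s| ≤ M) ∧ ∀ x : ℝ, x^2 * E 0 (x^2) = Real.cos x - 1 := by
  obtain ⟨C, hC, hcos⟩ := aux_series
  let A : ℝ → ℝ := fun s => 1 + s * C s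
  have hA : ContDiff ℝ (⊤ : ℕ∞) A := by fun_prop
  have hAcos : ∀ x : ℝ, A (x^2) = Real.cos x := fun x => by simp [A, hcos]
  let a : ℕ → ℝ → ℝ := fun k => iteratedDeriv k A
  let c : ℕ → ℝ → ℝ := fun k => iteratedDeriv k C
  have ha : ∀ k s, HasDerivAt (a k) (a (k+1) s) s := aux_iter hA
  have hc : ∀ k s, HasDerivAt (c k) (c (k+1) s) s := aux_iter hC
  have ha0 : a 0 = A := iteratedDeriv_zero
  have hc0 : c 0 = C := iteratedDeriv_zero
  -- relation
  have hrel : ∀ k s, s * c (k+1) s + (k+1) * c k s = a (k+1) s := by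
    intro k
    induction k with
    | zero =>
      intro s
      have h1 := ((hasDerivAt_id s).mul (hc 0 s)).const_add 1
      have h2 := ha 0 s
      rw [ha0] at h2
      have h3 := h2.unique (by rw [hc0] at h1; exact h1)
      simp at h3 ⊢
      rw [h3, hc0]; ring
    | succ k ih =>
      intro s
      have h1 := ((hasDerivAt_id s).mul (hc (k+1) s)).add ((hc k s).const_mul ((k:ℝ)+1))
      have h2 := ha (k+1) s
      rw [← funext ih] at h2
      have h3 := h2.unique h1
      simp at h3 ⊢
      rw [h3]; ring
  have hd1 : ∀ x : ℝ, 2 * x * a 1 (x^2) = - Real.sin x := by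
    intro x
    have h1 := (ha 0 (x^2)).comp x (hasDerivAt_pow 2 x)
    have h2 := Real.hasDerivAt_cos x
    rw [← funext hAcos] at h2
    rw [ha0] at h1
    have := h2.unique h1
    rw [this]; simp; ring
  have hd2 : ∀ x : ℝ, 2 * a 1 (x^2) + 4 * x^2 * a 2 (x^2) = - a 0 (x^2) := by
    intro x
    have h1 := ((hasDerivAt_id x).const_mul 2).mul ((ha 1 (x^2)).comp x (hasDerivAt_pow 2 x))
    have h2 := (Real.hasDerivAt_sin x).neg
    have e : (-Real.sin) = (fun x : ℝ => 2 * x * a 1 (x^2)) := by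
      funext y; simp [hd1]
    rw [e] at h2
    have := h2.unique h1
    rw [ha0, hAcos, this]; simp; ring
  have hode : ∀ k : ℕ, ∀ s : ℝ, 0 < s → 4 * s * a (k+2) s + (4*k+2) * a (k+1) s + a k s = 0 := by
    intro k
    induction k with
    | zero =>
      intro s hs
      have := hd2 (Real.sqrt s)
      rw [Real.sq_sqrt hs.le] at this
      simp; linarith
    | succ k ih =>
      intro s hs
      have h1 := (((hasDerivAt_id s).const_mul 4).mul (ha (k+2) s)).add
        (((ha (k+1) s).const_mul (4*(k:ℝ)+2)).add (ha k s))
      have h2 : HasDerivAt (fun _ : ℝ => (0:ℝ)) 0 s := hasDerivAt_const _ _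
      have h3 := h1.congr_of_eventuallyEq (f₁ := fun _ => 0) (by
        filter_upwards [lt_mem_nhds hs] with t ht
        have := ih t ht
        simp; linarith)
      have h4 := h2.unique h3
      simp at h4
      push_cast
      rw [show k+1+2 = k+2+1 by ring, show k+1+1 = k+2 by ring]
      rw [show k+1+1 = k+2 by ring] at h4
      linarith
  have hab : ∀ k, ∃ M, ∀ s, 1 ≤ s → |a k s| ≤ M := by
    have : ∀ k, (∃ M, ∀ s, 1 ≤ s → |a k s| ≤ M) ∧ (∃ M, ∀ s, 1 ≤ s → |a (k+1) s| ≤ M) := by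
      intro k
      induction k with
      | zero =>
        refine ⟨⟨1, fun s hs => ?_⟩, ⟨1, fun s hs => ?_⟩⟩
        · have := hAcos (Real.sqrt s)
          rw [Real.sq_sqrt (by linarith)] at this
          rw [ha0, this]; exact Real.abs_cos_le_one _
        · have := hd1 (Real.sqrt s)
          rw [Real.sq_sqrt (by linarith)] at this
          have h1 : 1 ≤ Real.sqrt s := Real.one_le_sqrt.2 hs
          have h2 := Real.abs_sin_le_one (Real.sqrt s)
          rw [← abs_neg, ← this, abs_mul, abs_of_pos (by linarith)] at h2
          simp only [zero_add]
          nlinarith [abs_nonneg (a 1 s)]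
      | succ k ih =>
        refine ⟨ih.2, ?_⟩
        obtain ⟨⟨M, hM⟩, ⟨M', hM'⟩⟩ := ih
        refine ⟨(4*k+2) * M' + M, fun s hs => ?_⟩
        have h0 := hode k s (by linarith)
        have h1 : 4 * s * a (k+2) s = -((4*k+2) * a (k+1) s + a k s) := by linarith
        have h2 : |4 * s * a (k+2) s| ≤ (4*k+2) * M' + M := by
          rw [h1, abs_neg]
          refine (abs_add_le _ _).trans (add_le_add ?_ (hM s hs))
          rw [abs_mul, abs_of_nonneg (by positivity)]
          exact mul_le_mul_of_nonneg_left (hM' s hs) (by positivity)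
        rw [abs_mul, abs_of_pos (by linarith)] at h2
        rw [show k+1+1 = k+2 by ring]
        nlinarith [abs_nonneg (a (k+2) s)]
    exact fun k => (this k).1
  have hcb : ∀ k, ∃ M, ∀ s, 1 ≤ s → |c k s| ≤ M := by
    intro k
    induction k with
    | zero =>
      obtain ⟨M, hM⟩ := hab 0
      refine ⟨M + 1, fun s hs => ?_⟩
      have h1 : s * c 0 s = a 0 s - 1 := by rw [hc0, ha0]; simp [A]
      have h2 : |s * c 0 s| ≤ M + 1 := by
        rw [h1]
        refine (abs_sub _ _).trans ?_
        have := hM s hs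
        simpa using this
      rw [abs_mul, abs_of_pos (by linarith)] at h2
      nlinarith [abs_nonneg (c 0 s)]
    | succ k ih =>
      obtain ⟨M, hM⟩ := ih
      obtain ⟨M', hM'⟩ := hab (k+1)
      refine ⟨M' + (k+1) * M, fun s hs => ?_⟩
      have h1 : s * c (k+1) s = a (k+1) s - (k+1) * c k s := by linarith [hrel k s]
      have h2 : |s * c (k+1) s| ≤ M' + (k+1) * M := by
        rw [h1]
        refine (abs_sub _ _).trans (add_le_add (hM' s hs) ?_)
        rw [abs_mul, abs_of_nonneg (by positivity)]
        exact mul_le_mul_of_nonneg_left (hM s hs) (by positivity)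
      rw [abs_mul, abs_of_pos (by linarith)] at h2
      nlinarith [abs_nonneg (c (k+1) s)]
  let X : ℝ → ℝ := fun s => Real.smoothTransition (s + 1) * C s
  have hX : ContDiff ℝ (⊤ : ℕ∞) X :=
    (Real.smoothTransition.contDiff.comp (contDiff_id.add contDiff_const)).mul hC
  refine ⟨fun k => iteratedDeriv k X, aux_iter hX, fun k => ?_, fun x => ?_⟩
  · obtain ⟨M, hM⟩ := hcb k
    have hcont : Continuous (iteratedDeriv k X) :=
      continuous_iff_continuousAt.2 fun s => (aux_iter hX k s).continuousAt
    obtain ⟨M', hM'⟩ := (isCompact_Icc (a := (-1:ℝ)) (b := 1)).exists_bound_of_continuousOn hcont.continuousOn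
    refine ⟨max 0 (max M M'), fun s => ?_⟩
    change |iteratedDeriv k X s| ≤ _
    rcases lt_or_ge s (-1) with h | h
    · have e : X =ᶠ[𝓝 s] fun _ => 0 := by
        filter_upwards [gt_mem_nhds h] with t ht
        simp [X, Real.smoothTransition.zero_of_nonpos (show t + 1 ≤ 0 by linarith)]
      rw [e.iteratedDeriv_eq k]
      simp [iteratedDeriv_const]
    · rcases le_or_gt s 1 with h' | h'
      · exact (hM' s ⟨h, h'⟩).trans (by simp)
      · have e : X =ᶠ[𝓝 s] C := by
          filter_upwards [lt_mem_nhds h'] with t ht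
          simp [X, Real.smoothTransition.one_of_one_le (show 1 ≤ t + 1 by linarith)]
        rw [e.iteratedDeriv_eq k]
        exact (hM s h'.le).trans (by simp)
  · change x^2 * iteratedDeriv 0 X (x^2) = _
    rw [iteratedDeriv_zero, ← hcos x]
    simp only [X]
    rw [Real.smoothTransition.one_of_one_le (by nlinarith [sq_nonneg x]), one_mul]

open MeasureTheory Complex in
theorem aux_smooth {Ω : Type*} [MeasurableSpace Ω] (μ : Measure Ω) (α β : Ω → ℝ)
    (hα : Measurable α) (hβ : Measurable β) (E : ℕ → ℝ → ℝ)
    (hE : ∀ k s, HasDerivAt (E k) (E (k+1) s) s) (hM : ∀ k, ∃ M, ∀ s, |E k s| ≤ M) (N : ℕ) :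
    ∀ (q : Ω → ℂ) (_ : ∀ m n : ℕ, Integrable (fun ω => q ω * (α ω : ℂ)^m * (β ω : ℂ)^n) μ) (k : ℕ),
    ContDiff ℝ N (fun p : ℝ × ℝ => ∫ ω, q ω * (cexp (I * ((p.1 * α ω : ℝ) : ℂ)) * ((E k (p.2 * β ω) : ℝ) : ℂ)) ∂μ) := by
  have hEm : ∀ k, Measurable (E k) := fun k =>
    (continuous_iff_continuousAt.2 fun s => (hE k s).continuousAt).measurable
  let L1 : ℝ × ℝ →L[ℝ] ℂ := ofRealCLM.comp (ContinuousLinearMap.fst ℝ ℝ ℝ)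
  let L2 : ℝ × ℝ →L[ℝ] ℂ := ofRealCLM.comp (ContinuousLinearMap.snd ℝ ℝ ℝ)
  have hmeas : ∀ (q : Ω → ℂ) (_ : AEStronglyMeasurable q μ) (k : ℕ) (p : ℝ × ℝ),
      AEStronglyMeasurable (fun ω => q ω * (cexp (I * ((p.1 * α ω : ℝ) : ℂ)) * ((E k (p.2 * β ω) : ℝ) : ℂ))) μ := by
    intro q hq k p
    refine hq.mul (Measurable.aestronglyMeasurable ?_)
    have := hEm k
    fun_prop
  have hnorm : ∀ (x y : ℝ) (z : ℂ), ‖z * (cexp (I * (x : ℂ)) * (y : ℂ))‖ = ‖z‖ * |y| := by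
    intro x y z
    rw [norm_mul, norm_mul, mul_comm I, norm_exp_ofReal_mul_I, one_mul, norm_real, Real.norm_eq_abs]
  have hint : ∀ (q : Ω → ℂ) (_ : Integrable q μ) (k : ℕ) (p : ℝ × ℝ),
      Integrable (fun ω => q ω * (cexp (I * ((p.1 * α ω : ℝ) : ℂ)) * ((E k (p.2 * β ω) : ℝ) : ℂ))) μ := by
    intro q hq k p
    obtain ⟨M, hM'⟩ := hM k
    refine Integrable.mono' (hq.norm.mul_const M) (hmeas q hq.1 k p) (Filter.Eventually.of_forall fun ω => ?_)
    rw [hnorm]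
    exact mul_le_mul_of_nonneg_left (hM' _) (norm_nonneg _)
  have key : ∀ (q : Ω → ℂ) (_ : ∀ m n : ℕ, Integrable (fun ω => q ω * (α ω : ℂ)^m * (β ω : ℂ)^n) μ) (k : ℕ) (p : ℝ × ℝ),
      HasFDerivAt (fun p : ℝ × ℝ => ∫ ω, q ω * (cexp (I * ((p.1 * α ω : ℝ) : ℂ)) * ((E k (p.2 * β ω) : ℝ) : ℂ)) ∂μ)
      ((∫ ω, (q ω * (I * α ω)) * (cexp (I * ((p.1 * α ω : ℝ) : ℂ)) * ((E k (p.2 * β ω) : ℝ) : ℂ)) ∂μ) • L1 +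
       (∫ ω, (q ω * β ω) * (cexp (I * ((p.1 * α ω : ℝ) : ℂ)) * ((E (k+1) (p.2 * β ω) : ℝ) : ℂ)) ∂μ) • L2) p := by
    intro q hq k p
    have hq0 : Integrable q μ := by simpa using hq 0 0
    have hq1 : Integrable (fun ω => q ω * (I * α ω)) μ := by
      have := (hq 1 0).const_mul I
      refine this.congr (Filter.Eventually.of_forall fun ω => ?_)
      simp; ring
    have hq2 : Integrable (fun ω => q ω * β ω) μ := by simpa using hq 0 1
    have i1 := (hint _ hq1 k p).smul_const L1
    have i2 := (hint _ hq2 (k+1) p).smul_const L2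
    obtain ⟨M, hM0⟩ := hM k
    obtain ⟨M', hM1⟩ := hM (k+1)
    have hL1 : ‖L1‖ ≤ 1 := by
      refine ContinuousLinearMap.opNorm_le_bound _ zero_le_one fun x => ?_
      simpa [L1] using norm_fst_le x
    have hL2 : ‖L2‖ ≤ 1 := by
      refine ContinuousLinearMap.opNorm_le_bound _ zero_le_one fun x => ?_
      simpa [L2] using norm_snd_le x
    have := hasFDerivAt_integral_of_dominated_of_fderiv_le (μ := μ) (𝕜 := ℝ) (s := Set.univ) (x₀ := p)
      (F := fun (p : ℝ × ℝ) ω => q ω * (cexp (I * ((p.1 * α ω : ℝ) : ℂ)) * ((E k (p.2 * β ω) : ℝ) : ℂ)))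
      (F' := fun (p : ℝ × ℝ) ω => ((q ω * (I * α ω)) * (cexp (I * ((p.1 * α ω : ℝ) : ℂ)) * ((E k (p.2 * β ω) : ℝ) : ℂ))) • L1 +
        ((q ω * β ω) * (cexp (I * ((p.1 * α ω : ℝ) : ℂ)) * ((E (k+1) (p.2 * β ω) : ℝ) : ℂ))) • L2)
      (bound := fun ω => ‖q ω * (I * α ω)‖ * M + ‖q ω * β ω‖ * M')
      Filter.univ_mem (Filter.Eventually.of_forall fun p => hmeas q hq0.1 k p) (hint q hq0 k p)
      (i1.add i2).1 ?_ ((hq1.norm.mul_const _).add (hq2.norm.mul_const _)) ?_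
    · rw [integral_add i1 i2, integral_smul_const, integral_smul_const] at this
      exact this
    · refine Filter.Eventually.of_forall fun ω x _ => ?_
      refine (norm_add_le _ _).trans (add_le_add ?_ ?_)
      · rw [norm_smul, hnorm]
        refine (mul_le_of_le_one_right (by positivity) hL1).trans ?_
        exact mul_le_mul_of_nonneg_left (hM0 _) (norm_nonneg _)
      · rw [norm_smul, hnorm]
        refine (mul_le_of_le_one_right (by positivity) hL2).trans ?_
        exact mul_le_mul_of_nonneg_left (hM1 _) (norm_nonneg _)
    · refine Filter.Eventually.of_forall fun ω x _ => ?_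
      have h1 : HasFDerivAt (fun p : ℝ × ℝ => ((p.1 * α ω : ℝ) : ℂ)) ((α ω : ℂ) • L1) x := by
        have : (fun p : ℝ × ℝ => ((p.1 * α ω : ℝ) : ℂ)) = ((α ω : ℂ) • L1 : ℝ × ℝ →L[ℝ] ℂ) := by
          funext p; simp [L1, mul_comm]
        rw [this]; exact ContinuousLinearMap.hasFDerivAt _
      have h2 := (h1.const_mul I).cexp
      have h3 : HasFDerivAt (fun p : ℝ × ℝ => ((E k (p.2 * β ω) : ℝ) : ℂ)) (((E (k+1) (x.2 * β ω) : ℝ) : ℂ) • ((β ω : ℂ) • L2)) x := by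
        have e : HasFDerivAt (fun p : ℝ × ℝ => p.2 * β ω) (β ω • ContinuousLinearMap.snd ℝ ℝ ℝ) x := by
          have : (fun p : ℝ × ℝ => p.2 * β ω) = (β ω • ContinuousLinearMap.snd ℝ ℝ ℝ : ℝ × ℝ →L[ℝ] ℝ) := by
            funext p; simp [mul_comm]
          rw [this]; exact ContinuousLinearMap.hasFDerivAt _
        have e2 := (hE k (x.2 * β ω)).comp_hasFDerivAt x e
        have e3 := ofRealCLM.hasFDerivAt.comp x e2
        convert! e3 using 1
        ext v <;> simp [L2]
      have h4 := (h2.mul h3).const_mul (q ω)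
      convert! h4 using 1
      ext v <;> simp [L1, L2] <;> ring
  induction N with
  | zero =>
    intro q hq k
    rw [Nat.cast_zero, contDiff_zero, continuous_iff_continuousAt]
    exact fun p => (key q hq k p).continuousAt
  | succ N ih =>
    intro q hq k
    rw [Nat.cast_add, Nat.cast_one, contDiff_succ_iff_fderiv]
    refine ⟨fun p => (key q hq k p).differentiableAt, by simp, ?_⟩
    rw [funext fun p => (key q hq k p).fderiv]
    refine ContDiff.add (ContDiff.smul (ih _ ?_ k) contDiff_const) (ContDiff.smul (ih _ ?_ (k+1)) contDiff_const)
    · intro m n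
      refine ((hq (m+1) n).const_mul I).congr (Filter.Eventually.of_forall fun ω => ?_)
      simp; ring
    · intro m n
      refine (hq m (n+1)).congr (Filter.Eventually.of_forall fun ω => ?_)
      simp; ring

open MeasureTheory Complex FourierTransform in
theorem aux_local (f : ℂ → ℂ) (hf : ContDiff ℝ (⊤ : ℕ∞) f) (hs : HasCompactSupport f)
    (heven : ∀ u v : ℝ, f ⟨u, -v⟩ = f ⟨u, v⟩) (hzero : ∀ u : ℝ, f ⟨u, 0⟩ = 0) :
    ∃ g : ℝ × ℝ → ℂ, ContDiff ℝ (⊤ : ℕ∞) g ∧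
      ∀ u v : ℝ, f ⟨u, v⟩ = ((v^2 : ℝ) : ℂ) * g (u, v^2) := by
  obtain ⟨E, hE, hM, hcos⟩ := aux_kernel
  let φ : SchwartzMap ℂ ℂ := hs.toSchwartzMap hf
  let q : SchwartzMap ℂ ℂ := 𝓕 φ
  have hinv : ∀ z : ℂ, f z = ∫ ζ, cexp (((2 * Real.pi * (ζ.re * z.re + ζ.im * z.im) : ℝ) : ℂ) * I) * q ζ := by
    intro z
    have h1 : 𝓕⁻ q = φ := FourierTransform.fourierInv_fourier_eq φ
    have h2 : f z = (𝓕⁻ q) z := by rw [h1]; rfl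
    rw [h2, SchwartzMap.fourierInv_coe, Real.fourierInv_eq']
    refine integral_congr_ae (Filter.Eventually.of_forall fun ζ => ?_)
    simp [Complex.inner, mul_comm, mul_assoc]
  have hmom : ∀ m n : ℕ, Integrable (fun ζ : ℂ => q ζ * ((2 * Real.pi * ζ.re : ℝ) : ℂ)^m *
      (((2 * Real.pi * ζ.im)^2 : ℝ) : ℂ)^n) := by
    intro m n
    refine Integrable.mono' ((q.integrable_pow_mul volume (m + 2*n)).const_mul ((2*Real.pi)^(m+2*n))) ?_ ?_
    · have := q.continuous
      exact Continuous.aestronglyMeasurable (by fun_prop)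
    · refine Filter.Eventually.of_forall fun ζ => ?_
      have hp := Real.pi_pos
      have h1 : ‖((2 * Real.pi * ζ.re : ℝ) : ℂ)‖ ≤ 2 * Real.pi * ‖ζ‖ := by
        rw [norm_real, Real.norm_eq_abs, abs_mul, abs_of_pos (by positivity)]
        exact mul_le_mul_of_nonneg_left (abs_re_le_norm ζ) (by positivity)
      have h2 : ‖(((2 * Real.pi * ζ.im)^2 : ℝ) : ℂ)‖ ≤ (2 * Real.pi * ‖ζ‖)^2 := by
        rw [norm_real, norm_pow, Real.norm_eq_abs, abs_mul, abs_of_pos (show 0 < 2 * Real.pi by positivity)]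
        gcongr
        exact abs_im_le_norm ζ
      rw [norm_mul, norm_mul, norm_pow, norm_pow]
      calc _ ≤ ‖q ζ‖ * (2 * Real.pi * ‖ζ‖)^m * ((2 * Real.pi * ‖ζ‖)^2)^n := by gcongr
        _ = _ := by rw [← pow_mul, mul_assoc, ← pow_add, mul_pow]; ring
  let q1 : ℂ → ℂ := fun ζ => q ζ * (((2 * Real.pi * ζ.im)^2 : ℝ) : ℂ)
  have hsm := fun N : ℕ => aux_smooth volume (fun ζ : ℂ => 2 * Real.pi * ζ.re) (fun ζ : ℂ => (2 * Real.pi * ζ.im)^2)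
    (by fun_prop) (by fun_prop) E hE hM N q1 (by
      intro m n
      refine (hmom m (n+1)).congr (Filter.Eventually.of_forall fun ω => ?_)
      simp only [q1]; ring) 0
  refine ⟨_, contDiff_infty.2 hsm, fun u v => ?_⟩
  have hint : ∀ z : ℂ, Integrable (fun ζ : ℂ => cexp (((2 * Real.pi * (ζ.re * z.re + ζ.im * z.im) : ℝ) : ℂ) * I) * q ζ) := by
    intro z
    refine Integrable.mono' q.integrable.norm ?_ ?_
    · have := q.continuous
      exact Continuous.aestronglyMeasurable (by fun_prop)
    · refine Filter.Eventually.of_forall fun ζ => ?_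
      rw [norm_mul, norm_exp_ofReal_mul_I, one_mul]
  have e1 : f ⟨u, v⟩ = (1/2) * (f ⟨u, v⟩ + f ⟨u, -v⟩) - f ⟨u, 0⟩ := by
    rw [heven, hzero]; ring
  rw [e1, hinv ⟨u, v⟩, hinv ⟨u, -v⟩, hinv ⟨u, 0⟩, ← integral_add (hint _) (hint _), ← integral_const_mul]
  refine (integral_sub (((hint ⟨u, v⟩).add (hint ⟨u, -v⟩)).const_mul (1/2)) (hint ⟨u, 0⟩)).symm.trans ?_
  rw [← integral_const_mul]
  refine integral_congr_ae (Filter.Eventually.of_forall fun ζ => ?_)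
  have hk : ((v : ℂ)^2) * (2 * Real.pi * ζ.im)^2 * ((E 0 (v^2 * (2 * Real.pi * ζ.im)^2) : ℝ) : ℂ)
      = (1/2) * (cexp ((2 * Real.pi * ζ.im * v : ℂ) * I) + cexp (-(2 * Real.pi * ζ.im * v : ℂ) * I)) - 1 := by
    have := hcos (v * (2 * Real.pi * ζ.im))
    rw [mul_pow] at this
    have h2 := congrArg (fun x : ℝ => (x : ℂ)) this
    push_cast at h2
    rw [h2, Complex.cos]
    rw [show (v : ℂ) * (2 * Real.pi * ζ.im) = 2 * Real.pi * ζ.im * v by ring]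
    ring
  simp only [q1, Pi.add_apply]
  have x1 : cexp (((2 * Real.pi * (ζ.re * u + ζ.im * v) : ℝ) : ℂ) * I) =
      cexp (I * ((u * (2 * Real.pi * ζ.re) : ℝ) : ℂ)) * cexp ((2 * Real.pi * ζ.im * v : ℂ) * I) := by
    rw [← Complex.exp_add]; congr 1; push_cast; ring
  have x2 : cexp (((2 * Real.pi * (ζ.re * u + ζ.im * -v) : ℝ) : ℂ) * I) =
      cexp (I * ((u * (2 * Real.pi * ζ.re) : ℝ) : ℂ)) * cexp (-(2 * Real.pi * ζ.im * v : ℂ) * I) := by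
    rw [← Complex.exp_add]; congr 1; push_cast; ring
  have x3 : cexp (((2 * Real.pi * (ζ.re * u + ζ.im * 0) : ℝ) : ℂ) * I) =
      cexp (I * ((u * (2 * Real.pi * ζ.re) : ℝ) : ℂ)) := by
    congr 1; push_cast; ring
  rw [x1, x2, x3]
  push_cast
  linear_combination (-(q ζ) * cexp (I * (u * (2 * Real.pi * ζ.re)))) * hk

open Filter Topology Manifold in
theorem aux_global (F : ℝ × ℝ → ℂ) (hF : ContDiff ℝ (⊤ : ℕ∞) F)
    (heven : ∀ u v : ℝ, F (u, -v) = F (u, v)) (hzero : ∀ u : ℝ, F (u, 0) = 0) :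
    ∃ g : ℝ × ℝ → ℂ, ContDiff ℝ (⊤ : ℕ∞) g ∧
      ∀ u v : ℝ, F (u, v) = ((v^2 : ℝ) : ℂ) * g (u, v^2) := by
  let t : ℝ × ℝ → Set ℂ := fun p => {z | ∀ v : ℝ, v^2 = p.2 → F (p.1, v) = (p.2 : ℂ) * z}
  have ht : ∀ p, Convex ℝ (t p) := by
    intro p z hz w hw a b ha hb hab v hv
    have h1 := hz v hv
    have h2 := hw v hv
    have h3 : (a : ℂ) + b = 1 := by exact_mod_cast hab
    simp only [Complex.real_smul]
    linear_combination (a : ℂ) * h1 + (b : ℂ) * h2 - F (p.1, v) * h3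
  obtain ⟨g, hg⟩ := exists_contMDiffMap_forall_mem_convex_of_local (n := (⊤ : ℕ∞)) 𝓘(ℝ, ℝ × ℝ) ht (by
    rintro ⟨u₀, w₀⟩
    rcases lt_trichotomy w₀ 0 with hw | hw | hw
    · refine ⟨{p | p.2 < 0}, (isOpen_lt continuous_snd continuous_const).mem_nhds hw, fun _ => 0,
        contMDiffOn_const, fun p hp v hv => ?_⟩
      have : p.2 < 0 := hp
      nlinarith [sq_nonneg v]
    · subst hw
      let b1 : ContDiffBump u₀ := ⟨1, 2, by norm_num, by norm_num⟩
      let b2 : ContDiffBump (0 : ℝ) := ⟨1, 2, by norm_num, by norm_num⟩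
      let f : ℂ → ℂ := fun z => ((b1 z.re * b2 z.im : ℝ) : ℂ) * F (z.re, z.im)
      have hfs : ContDiff ℝ (⊤ : ℕ∞) f := by
        have hr : ContDiff ℝ (⊤ : ℕ∞) Complex.re := Complex.reCLM.contDiff
        have hi : ContDiff ℝ (⊤ : ℕ∞) Complex.im := Complex.imCLM.contDiff
        refine ContDiff.mul (Complex.ofRealCLM.contDiff.comp ?_) (hF.comp (hr.prodMk hi))
        exact (b1.contDiff.comp hr).mul (b2.contDiff.comp hi)
      have hfc : HasCompactSupport f := by
        have hK : IsCompact (Complex.equivRealProdCLM ⁻¹' (Metric.closedBall u₀ 2 ×ˢ Metric.closedBall (0:ℝ) 2)) := by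
          exact Complex.equivRealProdCLM.toHomeomorph.isCompact_preimage.2
            ((isCompact_closedBall _ _).prod (isCompact_closedBall _ _))
        refine HasCompactSupport.intro hK fun z hz => ?_
        simp only [f]
        by_cases h1 : z.re ∈ Metric.closedBall u₀ 2
        · have h2 : z.im ∉ Metric.closedBall (0:ℝ) 2 := fun h2 => hz ⟨h1, h2⟩
          rw [b2.zero_of_le_dist (not_le.1 h2).le]
          simp
        · rw [b1.zero_of_le_dist (not_le.1 h1).le]
          simp
      obtain ⟨g, hgs, hg⟩ := aux_local f hfs hfc
        (fun u v => by simp only [f]; rw [heven, b2.neg]) (fun u => by simp [f, hzero])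
      refine ⟨{p | dist p.1 u₀ < 1 ∧ p.2 < 1}, ?_, g, hgs.contMDiff.contMDiffOn, fun p hp v hv => ?_⟩
      · refine IsOpen.mem_nhds ?_ (by simp)
        exact (isOpen_lt (continuous_fst.dist continuous_const) continuous_const).inter (isOpen_lt continuous_snd continuous_const)
      · have h1 := hg p.1 v
        simp only [f] at h1
        have hv1 : |v| ≤ 1 := by
          rw [← sq_le_one_iff_abs_le_one, hv]; exact hp.2.le
        rw [b1.one_of_mem_closedBall (Metric.mem_closedBall.2 hp.1.le),
          b2.one_of_mem_closedBall (by simpa [b2] using hv1), hv] at h1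
        simpa using h1
    · refine ⟨{p | 0 < p.2}, (isOpen_lt continuous_const continuous_snd).mem_nhds hw,
        fun p => F (p.1, Real.sqrt p.2) * ((p.2⁻¹ : ℝ) : ℂ), ?_, fun p hp v hv => ?_⟩
      · rw [contMDiffOn_iff_contDiffOn]
        intro p hp
        have hp' : p.2 ≠ 0 := ne_of_gt hp
        apply ContDiffAt.contDiffWithinAt
        refine ContDiffAt.mul (hF.contDiffAt.comp p (contDiffAt_fst.prodMk (contDiffAt_snd.sqrt hp'))) ?_
        exact Complex.ofRealCLM.contDiff.contDiffAt.comp p (contDiffAt_snd.inv hp')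
      · have hp' : (p.2 : ℂ) ≠ 0 := by exact_mod_cast (ne_of_gt hp)
        have : F (p.1, v) = F (p.1, Real.sqrt p.2) := by
          rw [← hv, Real.sqrt_sq_eq_abs]
          rcases abs_choice v with h | h <;> rw [h]
          rw [heven]
        rw [this]
        push_cast
        field_simp)
  exact ⟨g, g.contMDiff.contDiff, fun u v => hg (u, v^2) v rfl⟩

/-- A smooth symmetric function of two real variables vanishing to second order on the
diagonal factors as `(ξ-η)²` times a smooth function of `ξ+η` and `(ξ-η)²`
(Whitney-type representation). -/
theorem stmt_15 (h : ℝ × ℝ → ℂ) (hsmooth : ContDiff ℝ (⊤ : ℕ∞) h)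
    (hsym : ∀ ξ η : ℝ, h (ξ, η) = h (η, ξ))
    (hvan : ∀ ξ : ℝ, h (ξ, ξ) = 0)
    (hvan₁ : ∀ ξ : ℝ, deriv (fun x : ℝ => h (x, ξ)) ξ = 0)
    (hvan₂ : ∀ ξ : ℝ, deriv (fun y : ℝ => h (ξ, y)) ξ = 0) :
    ∃ g : ℝ × ℝ → ℂ, ContDiff ℝ (⊤ : ℕ∞) g ∧
      ∀ ξ η : ℝ, h (ξ, η) = (((ξ - η) ^ 2 : ℝ) : ℂ) * g (ξ + η, (ξ - η) ^ 2) := by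
  obtain ⟨g, hg, hgF⟩ := aux_global (fun p => h ((p.1 + p.2) / 2, (p.1 - p.2) / 2))
    (hsmooth.comp (by fun_prop))
    (fun u v => by
      rw [hsym]
      simp only [sub_neg_eq_add, ← sub_eq_add_neg])
    (fun u => by simpa using hvan (u / 2))
  refine ⟨g, hg, fun ξ η => ?_⟩
  rw [← hgF]
  congr 2 <;> ring
end

section
/- Let δ ≤ 0 and s ∈ ℝ with s ≥ δ + 1/2, and assume additionally that δ < 0 or s > 1/2. Let c : ℝ³ → ℂ be smooth and satisfy, for every multi-index α = (α₁,α₂,α₃), the bound |∂^α c(ξ₁,ξ₂,ξ₃)| ≤ c_α ⟨ξ₁⟩^{δ-α₁}⟨ξ₂⟩^{δ-α₂}⟨ξ₃⟩^{δ-α₃} for all (ξ₁,ξ₂,ξ₃) ∈ ℝ³, where ⟨ξ⟩ := (1+ξ²)^{1/2}. Define, for Schwartz functions u₁, u₂, u₃ on ℝ, the translation-invariant trilinear form C(u₁, ū₂, u₃)(x) := (2π)^{-3} ∭ e^{ix(ξ₁-ξ₂+ξ₃)} c(ξ₁,ξ₂,ξ₃) û₁(ξ₁) conj(û₂(ξ₂))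 û₃(ξ₃) dξ₁ dξ₂ dξ₃. Then there is a constant C', depending only on s, δ and finitely many of the constants c_α, such that ‖C(u₁, ū₂, u₃)‖_{H^s} ≤ C' ‖u₁‖_{H^s} ‖u₂‖_{H^s} ‖u₃‖_{H^s}, where ‖u‖²_{H^s} := (2π)^{-1} ∫_ℝ ⟨ξ⟩^{2s} |û(ξ)|² dξ. -/
open MeasureTheory Set

/-- The partial derivative of a function on `ℝ³` in the `j`-th coordinate direction. -/
noncomputable def pd (j : Fin 3) (f : (Fin 3 → ℝ) → ℂ) : (Fin 3 → ℝ) → ℂ :=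
  fun x => fderiv ℝ f x (Pi.single j 1)

/-- The iterated partial derivative `∂^α` for a multi-index `α : Fin 3 → ℕ`. -/
noncomputable def pdMulti (α : Fin 3 → ℕ) (f : (Fin 3 → ℝ) → ℂ) : (Fin 3 → ℝ) → ℂ :=
  (pd 0)^[α 0] ((pd 1)^[α 1] ((pd 2)^[α 2] f))

/-- The Sobolev norm `‖u‖_{H^s}`, via `‖u‖²_{H^s} = (2π)⁻¹ ∫ ⟨ξ⟩^{2s} |û(ξ)|² dξ`. -/
noncomputable def HsNorm (s : ℝ) (f : ℝ → ℂ) : ℝ :=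
  Real.sqrt ((2 * Real.pi)⁻¹ * ∫ ξ : ℝ, ((1 + ξ ^ 2) ^ s) * ‖FT f ξ‖ ^ 2)

/-- The translation-invariant trilinear form with symbol `c`:
`C(u₁, ū₂, u₃)(x) = (2π)^{-3} ∭ e^{ix(ξ₁-ξ₂+ξ₃)} c(ξ) û₁(ξ₁) conj(û₂(ξ₂)) û₃(ξ₃) dξ`. -/
noncomputable def Cform (c : (Fin 3 → ℝ) → ℂ) (u₁ u₂ u₃ : ℝ → ℂ) (x : ℝ) : ℂ :=
  (((2 * Real.pi) ^ 3 : ℝ) : ℂ)⁻¹ *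
    ∫ ξ₁ : ℝ, ∫ ξ₂ : ℝ, ∫ ξ₃ : ℝ,
      Complex.exp (Complex.I * (x : ℂ) * ((ξ₁ : ℂ) - (ξ₂ : ℂ) + (ξ₃ : ℂ))) *
        c ![ξ₁, ξ₂, ξ₃] * FT u₁ ξ₁ * (starRingEnd ℂ) (FT u₂ ξ₂) * FT u₃ ξ₃

open scoped ENNReal FourierTransform

lemma aux_weight (δ s : ℝ) (hδ : δ ≤ 0) (hs : δ + 1 / 2 ≤ s)
    (hstrict : δ < 0 ∨ 1 / 2 < s) : ∃ e C : ℝ, e < -1/2 ∧ 0 ≤ C ∧ ∀ x y z w : ℝ, w = x - y + z →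
      (1 + w^2)^s * ((1+x^2)^(δ-s) * (1+y^2)^(δ-s) * (1+z^2)^(δ-s)) ≤
        C * ((1+x^2)^e * (1+y^2)^e + (1+x^2)^e * (1+z^2)^e + (1+y^2)^e * (1+z^2)^e) := by
  obtain ⟨t, ht0, hts, hE, hlt⟩ : ∃ t : ℝ, 0 ≤ t ∧ s ≤ t ∧ δ - s + t ≤ 0 ∧
      δ - s + (δ - s + t)/2 < -1/2 := by
    rcases le_total 0 s with h | h
    · refine ⟨s, h, le_rfl, by linarith, ?_⟩
      rcases hstrict with h' | h' <;> linarith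
    · exact ⟨0, le_rfl, h, by linarith, by linarith⟩
  refine ⟨δ - s + (δ - s + t)/2, 9^t, hlt, by positivity, ?_⟩
  have key : ∀ X Y Z W : ℝ, 1 ≤ X → 1 ≤ Y → 1 ≤ Z → 1 ≤ W → W ≤ 9 * X → Y ≤ X → Z ≤ X →
      W^s * (X^(δ-s) * Y^(δ-s) * Z^(δ-s)) ≤
        9^t * (Y^(δ - s + (δ - s + t)/2) * Z^(δ - s + (δ - s + t)/2)) := by
    intro X Y Z W hX hY hZ hW h9 hYX hZX
    have hX0 : 0 < X := by linarith
    have hY0 : 0 < Y := by linarith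
    have hZ0 : 0 < Z := by linarith
    have h1 : W^s ≤ 9^t * X^t := by
      calc W^s ≤ W^t := Real.rpow_le_rpow_of_exponent_le hW hts
        _ ≤ (9*X)^t := Real.rpow_le_rpow (by linarith) h9 ht0
        _ = _ := Real.mul_rpow (by norm_num) hX0.le
    have h2 : X^t * X^(δ-s) = X^((δ-s+t)/2) * X^((δ-s+t)/2) := by
      rw [← Real.rpow_add hX0, ← Real.rpow_add hX0]; congr 1; ring
    have h3 : X^((δ-s+t)/2) ≤ Y^((δ-s+t)/2) :=
      Real.rpow_le_rpow_of_nonpos hY0 hYX (by linarith)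
    have h4 : X^((δ-s+t)/2) ≤ Z^((δ-s+t)/2) :=
      Real.rpow_le_rpow_of_nonpos hZ0 hZX (by linarith)
    calc W^s * (X^(δ-s) * Y^(δ-s) * Z^(δ-s)) ≤ (9^t * X^t) * (X^(δ-s) * Y^(δ-s) * Z^(δ-s)) := by
          gcongr
      _ = 9^t * ((X^t * X^(δ-s)) * (Y^(δ-s) * Z^(δ-s))) := by ring
      _ = 9^t * ((X^((δ-s+t)/2) * X^((δ-s+t)/2)) * (Y^(δ-s) * Z^(δ-s))) := by rw [h2]
      _ ≤ 9^t * ((Y^((δ-s+t)/2) * Z^((δ-s+t)/2)) * (Y^(δ-s) * Z^(δ-s))) := by gcongr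
      _ = _ := by rw [Real.rpow_add hY0, Real.rpow_add hZ0]; ring
  intro x y z w hw
  have h9 : ∀ m : ℝ, x^2 ≤ m → y^2 ≤ m → z^2 ≤ m → 1 + w^2 ≤ 9 * (1 + m) := by
    intro m h1 h2 h3
    rw [hw]
    nlinarith [sq_nonneg (x+y), sq_nonneg (x-z), sq_nonneg (y+z)]
  have px : 1 ≤ 1 + x^2 := by nlinarith
  have py : 1 ≤ 1 + y^2 := by nlinarith
  have pz : 1 ≤ 1 + z^2 := by nlinarith
  have pw : 1 ≤ 1 + w^2 := by nlinarith
  set e := δ - s + (δ - s + t)/2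
  have q1 : 0 ≤ 9^t * ((1+x^2)^e * (1+y^2)^e) := by positivity
  have q2 : 0 ≤ 9^t * ((1+x^2)^e * (1+z^2)^e) := by positivity
  have q3 : 0 ≤ 9^t * ((1+y^2)^e * (1+z^2)^e) := by positivity
  rcases le_total (x^2) (y^2) with h | h <;> rcases le_total (y^2) (z^2) with h' | h' <;>
    rcases le_total (x^2) (z^2) with h'' | h''
  all_goals first
    | (have := key (1+x^2) (1+y^2) (1+z^2) (1+w^2) px py pz pw
        (h9 _ (by linarith) (by linarith) (by linarith)) (by linarith) (by linarith)
       linarith)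
    | (have := key (1+y^2) (1+x^2) (1+z^2) (1+w^2) py px pz pw
        (h9 _ (by linarith) (by linarith) (by linarith)) (by linarith) (by linarith)
       linarith)
    | (have := key (1+z^2) (1+x^2) (1+y^2) (1+w^2) pz px py pw
        (h9 _ (by linarith) (by linarith) (by linarith)) (by linarith) (by linarith)
       linarith)

lemma aux_schwartz (u : SchwartzMap ℝ ℂ) : ∃ v : SchwartzMap ℝ ℂ, ∀ ξ, FT u ξ = v ξ := by
  have h2 : (2 * Real.pi)⁻¹ ≠ 0 := by positivity
  refine ⟨SchwartzMap.compCLMOfContinuousLinearEquiv ℂ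
    (ContinuousLinearEquiv.unitsEquivAut ℝ (Units.mk0 _ h2)) (𝓕 u), fun ξ => ?_⟩
  rw [SchwartzMap.compCLMOfContinuousLinearEquiv_apply, Function.comp_apply,
    SchwartzMap.fourier_coe, Real.fourier_real_eq_integral_exp_smul, FT]
  congr 1
  ext x
  rw [smul_eq_mul]
  congr 2
  simp
  have : (Real.pi : ℂ) ≠ 0 := by exact_mod_cast Real.pi_ne_zero
  field_simp

lemma aux_integrable (s : ℝ) (v : SchwartzMap ℝ ℂ) :
    Integrable (fun ξ : ℝ => (1 + ξ^2)^s * ‖v ξ‖^2) := by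
  have hg : (fun x : ℝ => (1 + ‖x‖^2)^(s/2)).HasTemperateGrowth :=
    Function.hasTemperateGrowth_one_add_norm_sq_rpow ℝ (s/2)
  have := (SchwartzMap.smulLeftCLM ℂ (fun x : ℝ => (1 + ‖x‖^2)^(s/2)) v).memLp 2 volume
  rw [memLp_two_iff_integrable_sq_norm this.1] at this
  refine this.congr (Filter.Eventually.of_forall fun x => ?_)
  simp only
  rw [SchwartzMap.smulLeftCLM_apply_apply hg, norm_smul, mul_pow, Real.norm_eq_abs, sq_abs,
    ← Real.rpow_natCast, ← Real.rpow_mul (by positivity), Real.norm_eq_abs, sq_abs]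
  congr 2
  push_cast; ring

lemma aux_cs {α : Type*} [MeasurableSpace α] (μ : Measure α) (f g : α → ℝ≥0∞)
    (hf : Measurable f) (hg : Measurable g) :
    (∫⁻ a, f a * g a ∂μ)^2 ≤ (∫⁻ a, f a ^ 2 ∂μ) * (∫⁻ a, g a ^ 2 ∂μ) := by
  have h := ENNReal.lintegral_mul_le_Lp_mul_Lq μ Real.HolderConjugate.two_two
    hf.aemeasurable hg.aemeasurable
  simp only [Pi.mul_apply, ENNReal.rpow_two] at h
  calc _ ≤ _ := pow_le_pow_left' h 2
    _ = _ := by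
      rw [mul_pow, ← ENNReal.rpow_two, ← ENNReal.rpow_two, ← ENNReal.rpow_mul, ← ENNReal.rpow_mul]
      norm_num

lemma aux_tonelli (a b d : ℝ → ℝ≥0∞) (ha : Measurable a) (hb : Measurable b) (hd : Measurable d) :
    ∫⁻ p : ℝ × ℝ, ∫⁻ η : ℝ, a p.1 * b p.2 * d (η - p.1 + p.2) =
      (∫⁻ x, a x) * (∫⁻ x, b x) * (∫⁻ x, d x) := by
  have : ∀ p : ℝ × ℝ, ∫⁻ η : ℝ, a p.1 * b p.2 * d (η - p.1 + p.2) =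
      a p.1 * b p.2 * ∫⁻ x, d x := by
    intro p
    rw [lintegral_const_mul _ (by fun_prop)]
    congr 1
    have := lintegral_add_right_eq_self (μ := volume) d (-p.1 + p.2)
    rw [← this]
    congr 1; ext η; congr 1; ring
  simp_rw [this]
  rw [lintegral_mul_const _ (by fun_prop)]
  congr 1
  exact lintegral_prod_mul ha.aemeasurable hb.aemeasurable

lemma aux_pairs (a : ℝ → ℝ≥0∞) (ha : Measurable a) (η : ℝ) :
    ∫⁻ p : ℝ × ℝ, (a p.1 * a p.2 + a p.1 * a (η - p.1 + p.2) + a p.2 * a (η - p.1 + p.2)) =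
      3 * (∫⁻ x, a x)^2 := by
  rw [lintegral_add_left (by fun_prop), lintegral_add_left (by fun_prop)]
  have h1 : ∫⁻ p : ℝ × ℝ, a p.1 * a p.2 = (∫⁻ x, a x)^2 := by
    rw [sq]; exact lintegral_prod_mul ha.aemeasurable ha.aemeasurable
  have h2 : ∫⁻ p : ℝ × ℝ, a p.1 * a (η - p.1 + p.2) = (∫⁻ x, a x)^2 := by
    rw [Measure.volume_eq_prod, lintegral_prod _ (by fun_prop)]
    have : ∀ x : ℝ, ∫⁻ y : ℝ, a x * a (η - x + y) = a x * ∫⁻ y, a y := by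
      intro x
      rw [lintegral_const_mul _ (by fun_prop), lintegral_add_left_eq_self]
    simp_rw [this]
    rw [lintegral_mul_const _ ha, sq]
  have h3 : ∫⁻ p : ℝ × ℝ, a p.2 * a (η - p.1 + p.2) = (∫⁻ x, a x)^2 := by
    rw [Measure.volume_eq_prod, lintegral_prod_symm _ (by fun_prop)]
    have : ∀ x : ℝ, ∫⁻ y : ℝ, a x * a (η - y + x) = a x * ∫⁻ y, a y := by
      intro x
      rw [lintegral_const_mul _ (by fun_prop)]
      congr 1
      rw [← lintegral_sub_left_eq_self a (η + x)]
      congr 1; ext η; congr 1; ring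
    simp_rw [this]
    rw [lintegral_mul_const _ ha, sq]
  rw [h1, h2, h3]; ring

noncomputable def Phi (c : (Fin 3 → ℝ) → ℂ) (v₁ v₂ v₃ : ℝ → ℂ) (p : ℝ × ℝ) (η : ℝ) : ℂ :=
  c ![p.1, p.2, η - p.1 + p.2] * v₁ p.1 * (starRingEnd ℂ) (v₂ p.2) * v₃ (η - p.1 + p.2)

lemma Phi_cont (c : (Fin 3 → ℝ) → ℂ) (hc : Continuous c) (v₁ v₂ v₃ : SchwartzMap ℝ ℂ) :
    Continuous (fun q : (ℝ × ℝ) × ℝ => Phi c v₁ v₂ v₃ q.1 q.2) := by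
  unfold Phi
  have h1 := v₁.continuous
  have h2 := v₂.continuous
  have h3 := v₃.continuous
  have h4 : Continuous (fun q : (ℝ × ℝ) × ℝ => ![q.1.1, q.1.2, q.2 - q.1.1 + q.1.2]) := by
    refine continuous_pi fun i => ?_
    fin_cases i <;> simp <;> fun_prop
  have h5 := hc.comp h4
  simp only [Function.comp_def] at h5
  have h6 : Continuous (fun z : ℂ => (starRingEnd ℂ) z) := Complex.continuous_conj
  fun_prop

lemma Phi_bound (c : (Fin 3 → ℝ) → ℂ) (K : ℝ) (hK : ∀ ξ, ‖c ξ‖ ≤ K) (v₁ v₂ v₃ : ℝ → ℂ)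
    (p : ℝ × ℝ) (η : ℝ) :
    ‖Phi c v₁ v₂ v₃ p η‖ ≤ K * (‖v₁ p.1‖ * ‖v₂ p.2‖ * ‖v₃ (η - p.1 + p.2)‖) := by
  unfold Phi
  rw [norm_mul, norm_mul, norm_mul, RCLike.norm_conj]
  have := hK ![p.1, p.2, η - p.1 + p.2]
  calc _ = ‖c ![p.1, p.2, η - p.1 + p.2]‖ * (‖v₁ p.1‖ * ‖v₂ p.2‖ * ‖v₃ (η - p.1 + p.2)‖) := by ring
    _ ≤ _ := by gcongr

lemma Phi_integrable (c : (Fin 3 → ℝ) → ℂ) (hc : Continuous c) (K : ℝ) (hK : ∀ ξ, ‖c ξ‖ ≤ K)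
    (v₁ v₂ v₃ : SchwartzMap ℝ ℂ) :
    Integrable (fun q : (ℝ × ℝ) × ℝ => Phi c v₁ v₂ v₃ q.1 q.2) := by
  have hcont := Phi_cont c hc v₁ v₂ v₃
  refine ⟨hcont.aestronglyMeasurable, ?_⟩
  have h1 := v₁.continuous
  have h2 := v₂.continuous
  have h3 := v₃.continuous
  have hK0 : 0 ≤ K := (norm_nonneg _).trans (hK 0)
  have m1 : Measurable (fun x => ‖v₁ x‖ₑ) := h1.measurable.enorm
  have m2 : Measurable (fun x => ‖v₂ x‖ₑ) := h2.measurable.enorm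
  have m3 : Measurable (fun x => ‖v₃ x‖ₑ) := h3.measurable.enorm
  have m4 : Measurable (fun q : (ℝ × ℝ) × ℝ => ‖v₁ q.1.1‖ₑ * ‖v₂ q.1.2‖ₑ
          * ‖v₃ (q.2 - q.1.1 + q.1.2)‖ₑ) :=
    ((m1.comp (by fun_prop)).mul (m2.comp (by fun_prop))).mul (m3.comp (by fun_prop))
  rw [hasFiniteIntegral_iff_enorm]
  calc ∫⁻ q : (ℝ × ℝ) × ℝ, ‖Phi c v₁ v₂ v₃ q.1 q.2‖ₑ
      ≤ ∫⁻ q : (ℝ × ℝ) × ℝ, ENNReal.ofReal K * (‖v₁ q.1.1‖ₑ * ‖v₂ q.1.2‖ₑ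
          * ‖v₃ (q.2 - q.1.1 + q.1.2)‖ₑ) := by
        refine lintegral_mono fun q => ?_
        have := Phi_bound c K hK v₁ v₂ v₃ q.1 q.2
        rw [← ofReal_norm]
        refine (ENNReal.ofReal_le_ofReal this).trans ?_
        rw [ENNReal.ofReal_mul hK0, ENNReal.ofReal_mul (by positivity),
          ENNReal.ofReal_mul (by positivity)]
        simp only [ofReal_norm]
        exact le_rfl
    _ = ENNReal.ofReal K * ((∫⁻ x, ‖v₁ x‖ₑ) * (∫⁻ x, ‖v₂ x‖ₑ) * (∫⁻ x, ‖v₃ x‖ₑ)) := by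
        rw [lintegral_const_mul _ m4, Measure.volume_eq_prod,
          lintegral_prod _ m4.aemeasurable]
        congr 1
        exact aux_tonelli _ _ _ m1 m2 m3
    _ < ⊤ := by
        have e1 := v₁.integrable (μ := volume).2
        have e2 := v₂.integrable (μ := volume).2
        have e3 := v₃.integrable (μ := volume).2
        rw [hasFiniteIntegral_iff_enorm] at e1 e2 e3
        exact ENNReal.mul_lt_top ENNReal.ofReal_lt_top
          (ENNReal.mul_lt_top (ENNReal.mul_lt_top e1 e2) e3)

set_option maxHeartbeats 1600000 in
lemma G_cont (c : (Fin 3 → ℝ) → ℂ) (hc : Continuous c) (K : ℝ) (hK : ∀ ξ, ‖c ξ‖ ≤ K)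
    (v₁ v₂ v₃ : SchwartzMap ℝ ℂ) :
    Continuous (fun η : ℝ => ∫ p : ℝ × ℝ, Phi c v₁ v₂ v₃ p η) := by
  have hcont := Phi_cont c hc v₁ v₂ v₃
  have hK0 : 0 ≤ K := (norm_nonneg _).trans (hK 0)
  obtain ⟨B, hB⟩ : ∃ B : ℝ, ∀ x, ‖v₃ x‖ ≤ B := by
    obtain ⟨B, _, hB⟩ := v₃.decay 0 0
    exact ⟨B, fun x => by simpa using hB x⟩
  refine continuous_of_dominated (bound := fun p => K * B * (‖v₁ p.1‖ * ‖v₂ p.2‖)) ?_ ?_ ?_ ?_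
  · intro η
    have hp : Continuous (fun p : ℝ × ℝ => ((p, η) : (ℝ × ℝ) × ℝ)) := by fun_prop
    have hp' : Continuous (fun p : ℝ × ℝ => Phi c v₁ v₂ v₃ p η) := hcont.comp hp
    exact hp'.aestronglyMeasurable
  · intro η
    refine Filter.Eventually.of_forall fun p => ?_
    refine (Phi_bound c K hK v₁ v₂ v₃ p η).trans ?_
    have := hB (η - p.1 + p.2)
    calc _ ≤ K * (‖v₁ p.1‖ * ‖v₂ p.2‖ * B) := by gcongr
      _ = _ := by ring
  · have i1 : Integrable (fun x => ‖v₁ x‖) volume := (v₁.integrable (μ := volume)).norm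
    have i2 : Integrable (fun x => ‖v₂ x‖) volume := (v₂.integrable (μ := volume)).norm
    have i3 : Integrable (fun p : ℝ × ℝ => ‖v₁ p.1‖ * ‖v₂ p.2‖) := Integrable.mul_prod i1 i2
    have i4 : Integrable (fun p : ℝ × ℝ => (K * B) * (‖v₁ p.1‖ * ‖v₂ p.2‖)) := i3.const_mul (K * B)
    exact i4
  · refine Filter.Eventually.of_forall fun p => ?_
    have hp : Continuous (fun η : ℝ => ((p, η) : (ℝ × ℝ) × ℝ)) := by fun_prop
    exact hcont.comp hp

lemma Cform_eq (c : (Fin 3 → ℝ) → ℂ) (hc : Continuous c) (K : ℝ) (hK : ∀ ξ, ‖c ξ‖ ≤ K)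
    (u₁ u₂ u₃ : ℝ → ℂ) (v₁ v₂ v₃ : SchwartzMap ℝ ℂ) (h₁ : ∀ ξ, FT u₁ ξ = v₁ ξ)
    (h₂ : ∀ ξ, FT u₂ ξ = v₂ ξ) (h₃ : ∀ ξ, FT u₃ ξ = v₃ ξ) (x : ℝ) :
    Cform c u₁ u₂ u₃ x = (((2 * Real.pi) ^ 3 : ℝ) : ℂ)⁻¹ *
      𝓕⁻ (fun η : ℝ => ∫ p : ℝ × ℝ, Phi c v₁ v₂ v₃ p η) (x / (2 * Real.pi)) := by
  unfold Cform
  congr 1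
  simp_rw [h₁, h₂, h₃]
  have hint := Phi_integrable c hc K hK v₁ v₂ v₃
  set H : ℝ × ℝ → ℝ → ℂ := fun p η => Complex.exp (Complex.I * x * η) * Phi c v₁ v₂ v₃ p η with hH
  have hn : ∀ η : ℝ, ‖Complex.exp (Complex.I * x * η)‖ = 1 := by
    intro η
    rw [show Complex.I * x * η = ((x * η : ℝ) : ℂ) * Complex.I by push_cast; ring]
    exact Complex.norm_exp_ofReal_mul_I _
  have hHint : Integrable (fun q : (ℝ × ℝ) × ℝ => H q.1 q.2) := by
    refine hint.bdd_mul (c := 1) ?_ ?_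
    · exact Continuous.aestronglyMeasurable (by fun_prop)
    · exact Filter.Eventually.of_forall fun q => (hn q.2).le
  have e1 : ∀ ξ₁ ξ₂ : ℝ, (∫ ξ₃ : ℝ, Complex.exp (Complex.I * (x : ℂ) * ((ξ₁ : ℂ) - (ξ₂ : ℂ) + (ξ₃ : ℂ))) *
        c ![ξ₁, ξ₂, ξ₃] * v₁ ξ₁ * (starRingEnd ℂ) (v₂ ξ₂) * v₃ ξ₃) = ∫ η : ℝ, H (ξ₁, ξ₂) η := by
    intro ξ₁ ξ₂
    rw [← integral_add_right_eq_self _ (-ξ₁ + ξ₂)]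
    congr 1
    ext η
    have : η + (-ξ₁ + ξ₂) = η - ξ₁ + ξ₂ := by ring
    simp only [hH, Phi, this]
    have : ((ξ₁ : ℂ) - (ξ₂ : ℂ) + ((η - ξ₁ + ξ₂ : ℝ) : ℂ)) = η := by push_cast; ring
    rw [this]
    ring
  simp_rw [e1]
  have hp : Integrable (fun p : ℝ × ℝ => ∫ η : ℝ, H p η) := hHint.integral_prod_left
  have e2 : ∫ ξ₁ : ℝ, ∫ ξ₂ : ℝ, ∫ η : ℝ, H (ξ₁, ξ₂) η = ∫ p : ℝ × ℝ, ∫ η : ℝ, H p η :=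
    (integral_prod _ hp).symm
  rw [e2, integral_integral_swap hHint, Real.fourierInv_eq']
  congr 1
  ext η
  simp only [hH]
  rw [integral_const_mul, smul_eq_mul]
  congr 2
  have : (Real.pi : ℂ) ≠ 0 := by exact_mod_cast Real.pi_ne_zero
  simp
  field_simp

lemma FT_Cform (c : (Fin 3 → ℝ) → ℂ) (hc : Continuous c) (K : ℝ) (hK : ∀ ξ, ‖c ξ‖ ≤ K)
    (u₁ u₂ u₃ : ℝ → ℂ) (v₁ v₂ v₃ : SchwartzMap ℝ ℂ) (h₁ : ∀ ξ, FT u₁ ξ = v₁ ξ)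
    (h₂ : ∀ ξ, FT u₂ ξ = v₂ ξ) (h₃ : ∀ ξ, FT u₃ ξ = v₃ ξ)
    (hi : Integrable (Cform c u₁ u₂ u₃)) (η : ℝ) :
    FT (Cform c u₁ u₂ u₃) η = (((2 * Real.pi) ^ 2 : ℝ) : ℂ)⁻¹ *
      ∫ p : ℝ × ℝ, Phi c v₁ v₂ v₃ p η := by
  have hpi : (Real.pi : ℂ) ≠ 0 := by exact_mod_cast Real.pi_ne_zero
  have h2pi : (2 * Real.pi) ≠ 0 := by positivity
  set G : ℝ → ℂ := fun η : ℝ => ∫ p : ℝ × ℝ, Phi c v₁ v₂ v₃ p η with hG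
  have hC := Cform_eq c hc K hK u₁ u₂ u₃ v₁ v₂ v₃ h₁ h₂ h₃
  have hGi : Integrable G := (Phi_integrable c hc K hK v₁ v₂ v₃).integral_prod_right
  have hGc : Continuous G := G_cont c hc K hK v₁ v₂ v₃
  have hFinv : Integrable (𝓕⁻ G) := by
    have h1 : Integrable (fun x => (((2 * Real.pi) ^ 3 : ℝ) : ℂ) * Cform c u₁ u₂ u₃ x) :=
      hi.const_mul _
    have h2 : (fun x => (((2 * Real.pi) ^ 3 : ℝ) : ℂ) * Cform c u₁ u₂ u₃ x) =
        fun x => 𝓕⁻ G (x / (2 * Real.pi)) := by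
      ext x
      rw [hC x, mul_inv_cancel_left₀]
      exact_mod_cast pow_ne_zero 3 h2pi
    rw [h2] at h1
    exact (integrable_comp_div_iff (𝓕⁻ G) h2pi).1 h1
  have hF : Integrable (𝓕 G) := by
    have := hFinv.comp_neg
    refine this.congr (Filter.Eventually.of_forall fun x => ?_)
    simp [Real.fourierInv_eq_fourier_neg]
  have hinv : 𝓕 (𝓕⁻ G) = G := hGc.fourier_fourierInv_eq hGi hF
  change FT (Cform c u₁ u₂ u₃) η = _ * G η
  rw [← congrFun hinv η, Real.fourier_real_eq_integral_exp_smul, FT]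
  rw [show (((2 * Real.pi) ^ 2 : ℝ) : ℂ)⁻¹ = (((2 * Real.pi) ^ 3 : ℝ) : ℂ)⁻¹ * (2 * Real.pi : ℝ) by
    push_cast; field_simp]
  rw [mul_assoc, ← integral_const_mul, ← integral_const_mul]
  have := Measure.integral_comp_div (fun y : ℝ => (((2 * Real.pi) ^ 3 : ℝ) : ℂ)⁻¹ * 
     (Complex.exp (↑(-2 * Real.pi * y * η) * Complex.I) • 𝓕⁻ G y)) (2 * Real.pi)
  rw [abs_of_pos (by positivity)] at this
  trans ∫ x : ℝ, (((2 * Real.pi) ^ 3 : ℝ) : ℂ)⁻¹ * 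
     (Complex.exp (↑(-2 * Real.pi * (x / (2 * Real.pi)) * η) * Complex.I) • 𝓕⁻ G (x / (2 * Real.pi)))
  · congr 1
    ext x
    rw [hC x, smul_eq_mul]
    have : -(Complex.I * (x:ℂ) * (η:ℂ)) =
      (↑(-2 * Real.pi * (x / (2 * Real.pi)) * η) * Complex.I) := by
      push_cast; field_simp
    rw [this]; ring
  · rw [this, ← integral_smul]
    congr 1
    ext x
    rw [Complex.real_smul]
    ring

set_option maxHeartbeats 1600000 in
lemma aux_main (s δ e C K : ℝ) (hC : 0 ≤ C) (hK : 0 ≤ K)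
    (hw : ∀ x y z w : ℝ, w = x - y + z →
      (1 + w^2)^s * ((1+x^2)^(δ-s) * (1+y^2)^(δ-s) * (1+z^2)^(δ-s)) ≤
        C * ((1+x^2)^e * (1+y^2)^e + (1+x^2)^e * (1+z^2)^e + (1+y^2)^e * (1+z^2)^e))
    (c : (Fin 3 → ℝ) → ℂ)
    (hc : ∀ x y z : ℝ, ‖c ![x, y, z]‖ ≤
      K * ((1+x^2)^(δ/2) * (1+y^2)^(δ/2) * (1+z^2)^(δ/2)))
    (v₁ v₂ v₃ : SchwartzMap ℝ ℂ) (g : ℝ → ℂ)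
    (hg : ∀ η, ‖g η‖ ≤ ‖∫ p : ℝ × ℝ, Phi c v₁ v₂ v₃ p η‖) :
    ∫⁻ η : ℝ, ENNReal.ofReal ((1 + η^2)^s * ‖g η‖^2) ≤
      ENNReal.ofReal (K^2 * C) * (3 * (∫⁻ x : ℝ, ENNReal.ofReal ((1+x^2)^e))^2) *
      ((∫⁻ x : ℝ, ENNReal.ofReal ((1 + x^2)^s * ‖v₁ x‖^2)) *
       (∫⁻ x : ℝ, ENNReal.ofReal ((1 + x^2)^s * ‖v₂ x‖^2)) *
       (∫⁻ x : ℝ, ENNReal.ofReal ((1 + x^2)^s * ‖v₃ x‖^2))) := by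
  set a : ℝ → ℝ≥0∞ := fun x => ENNReal.ofReal ((1+x^2)^e) with ha
  have ham : Measurable a := by fun_prop
  set D : SchwartzMap ℝ ℂ → ℝ → ℝ≥0∞ := fun v x => ENNReal.ofReal ((1 + x^2)^s * ‖v x‖^2) with hD
  have hDm : ∀ v, Measurable (D v) := by
    intro v
    have := v.continuous.measurable.norm
    exact ENNReal.measurable_ofReal.comp ((by fun_prop : Measurable fun x : ℝ => (1+x^2)^s).mul
      (this.pow_const 2))
  set A : ℝ → ℝ × ℝ → ℝ := fun η p =>
    K * ((1+p.1^2)^((δ-s)/2) * (1+p.2^2)^((δ-s)/2) * (1+(η-p.1+p.2)^2)^((δ-s)/2)) with hA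
  set B : ℝ → ℝ × ℝ → ℝ := fun η p =>
    ((1+p.1^2)^(s/2) * ‖v₁ p.1‖) * ((1+p.2^2)^(s/2) * ‖v₂ p.2‖) *
      ((1+(η-p.1+p.2)^2)^(s/2) * ‖v₃ (η-p.1+p.2)‖) with hB
  have hA0 : ∀ η p, 0 ≤ A η p := fun η p => by simp only [hA]; positivity
  have hB0 : ∀ η p, 0 ≤ B η p := fun η p => by simp only [hB]; positivity
  have hsq : ∀ (x r : ℝ), ((1 + x^2)^(r/2))^2 = (1+x^2)^r := by
    intro x r
    rw [← Real.rpow_natCast, ← Real.rpow_mul (by positivity)]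
    congr 1; push_cast; ring
  have hadd : ∀ (x : ℝ), (1 + x^2)^((δ-s)/2) * (1+x^2)^(s/2) = (1+x^2)^(δ/2) := by
    intro x
    rw [← Real.rpow_add (by positivity)]
    congr 1; ring
  have hPhi : ∀ η p, ‖Phi c v₁ v₂ v₃ p η‖ ≤ A η p * B η p := by
    intro η p
    unfold Phi
    rw [norm_mul, norm_mul, norm_mul, RCLike.norm_conj]
    have := hc p.1 p.2 (η-p.1+p.2)
    calc _ = ‖c ![p.1, p.2, η - p.1 + p.2]‖ * (‖v₁ p.1‖ * ‖v₂ p.2‖ * ‖v₃ (η - p.1 + p.2)‖) := by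
          ring
      _ ≤ _ := mul_le_mul_of_nonneg_right this (by positivity)
      _ = _ := by
        simp only [hA, hB]
        rw [← hadd p.1, ← hadd p.2, ← hadd (η-p.1+p.2)]
        ring
  have hn := fun v : SchwartzMap ℝ ℂ => v.continuous.measurable.norm
  have hAm : ∀ η, Measurable (A η) := by
    intro η; simp only [hA]; fun_prop
  have hBm : Measurable (fun q : ℝ × (ℝ × ℝ) => B q.1 q.2) := by
    simp only [hB]
    have n1 := (hn v₁).comp (by fun_prop : Measurable fun q : ℝ × (ℝ × ℝ) => q.2.1)
    have n2 := (hn v₂).comp (by fun_prop : Measurable fun q : ℝ × (ℝ × ℝ) => q.2.2)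
    have n3 := (hn v₃).comp (by fun_prop : Measurable fun q : ℝ × (ℝ × ℝ) => q.1 - q.2.1 + q.2.2)
    exact ((Measurable.mul (by fun_prop) n1).mul (Measurable.mul (by fun_prop) n2)).mul
      (Measurable.mul (by fun_prop) n3)
  have hBsq : ∀ η p, ENNReal.ofReal (B η p) ^ 2 = D v₁ p.1 * D v₂ p.2 * D v₃ (η - p.1 + p.2) := by
    intro η p
    simp only [hD]
    rw [← ENNReal.ofReal_pow (hB0 η p), ← ENNReal.ofReal_mul (by positivity),
      ← ENNReal.ofReal_mul (by positivity)]
    congr 1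
    simp only [hB, mul_pow, hsq]
  clear_value B D
  have hptw : ∀ η, ENNReal.ofReal ((1 + η^2)^s * ‖g η‖^2) ≤
      ENNReal.ofReal (K^2 * C) * (3 * (∫⁻ x, a x)^2) *
        ∫⁻ p : ℝ × ℝ, D v₁ p.1 * D v₂ p.2 * D v₃ (η - p.1 + p.2) := by
    intro η
    have h1 : ENNReal.ofReal ‖g η‖ ≤ ∫⁻ p, ENNReal.ofReal (A η p) * ENNReal.ofReal (B η p) := by
      refine (ENNReal.ofReal_le_ofReal (hg η)).trans ?_
      rw [ofReal_norm]
      refine (enorm_integral_le_lintegral_enorm _).trans (lintegral_mono fun p => ?_)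
      rw [← ofReal_norm, ← ENNReal.ofReal_mul (hA0 η p)]
      exact ENNReal.ofReal_le_ofReal (hPhi η p)
    have hBm' : Measurable (B η) := by
      have hp : Measurable (fun p : ℝ × ℝ => ((η, p) : ℝ × (ℝ × ℝ))) := by fun_prop
      exact Measurable.comp (g := fun q : ℝ × (ℝ × ℝ) => B q.1 q.2) hBm hp
    have mA : Measurable (fun p => ENNReal.ofReal (A η p)) := (hAm η).ennreal_ofReal
    have mB : Measurable (fun p => ENNReal.ofReal (B η p)) := hBm'.ennreal_ofReal
    have hcs := aux_cs volume (fun p => ENNReal.ofReal (A η p)) (fun p => ENNReal.ofReal (B η p))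
      mA mB
    have h2 : ENNReal.ofReal ‖g η‖ ^ 2 ≤ (∫⁻ p, ENNReal.ofReal (A η p) ^ 2) *
        ∫⁻ p : ℝ × ℝ, D v₁ p.1 * D v₂ p.2 * D v₃ (η - p.1 + p.2) := by
      have h3 := pow_le_pow_left' h1 2
      simp only [hBsq] at hcs
      exact h3.trans hcs
    rw [ENNReal.ofReal_mul (by positivity), ENNReal.ofReal_pow (norm_nonneg _)]
    refine (mul_le_mul_right h2 _).trans ?_
    rw [← mul_assoc]
    refine mul_le_mul_left ?_ _
    rw [← lintegral_const_mul _ ((hAm η).ennreal_ofReal.pow_const 2), ← aux_pairs a ham η,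
      ← lintegral_const_mul _ (by fun_prop)]
    refine lintegral_mono fun p => ?_
    simp only [ha]
    rw [← ENNReal.ofReal_pow (hA0 η p), ← ENNReal.ofReal_mul (by positivity),
      ← ENNReal.ofReal_mul (by positivity), ← ENNReal.ofReal_mul (by positivity),
      ← ENNReal.ofReal_mul (by positivity), ← ENNReal.ofReal_add (by positivity) (by positivity),
      ← ENNReal.ofReal_add (by positivity) (by positivity), ← ENNReal.ofReal_mul (by positivity)]
    refine ENNReal.ofReal_le_ofReal ?_
    simp only [hA, mul_pow, hsq]
    have := mul_le_mul_of_nonneg_left (hw p.1 p.2 (η-p.1+p.2) η (by ring)) (sq_nonneg K)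
    linarith
  refine (lintegral_mono hptw).trans ?_
  have hm : Measurable (fun q : ℝ × (ℝ × ℝ) => D v₁ q.2.1 * D v₂ q.2.2 * D v₃ (q.1 - q.2.1 + q.2.2)) :=
    (((hDm v₁).comp (by fun_prop)).mul ((hDm v₂).comp (by fun_prop))).mul
      ((hDm v₃).comp (by fun_prop))
  rw [lintegral_const_mul _ hm.lintegral_prod_right', lintegral_lintegral_swap hm.aemeasurable,
    aux_tonelli _ _ _ (hDm v₁) (hDm v₂) (hDm v₃)]
  subst hD
  exact le_rfl

/-- Fixed-time trilinear Sobolev boundedness `C : H^s × H^s × H^s → H^s` for a cubic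
nonlinearity whose symbol satisfies the Hörmander–Mihlin type bounds
`|∂^α c| ≤ c_α ∏ ⟨ξⱼ⟩^{δ-αⱼ}`, in the regime `δ ≤ 0`, `s ≥ δ + 1/2`, with `δ < 0` or
`s > 1/2`. -/
theorem stmt_18 (δ s : ℝ) (hδ : δ ≤ 0) (hs : δ + 1 / 2 ≤ s)
    (hstrict : δ < 0 ∨ 1 / 2 < s) (cα : (Fin 3 → ℕ) → ℝ) :
    ∃ C' : ℝ,
      ∀ c : (Fin 3 → ℝ) → ℂ, ContDiff ℝ (⊤ : ℕ∞) c →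
      (∀ (α : Fin 3 → ℕ) (ξ : Fin 3 → ℝ),
          ‖pdMulti α c ξ‖ ≤ cα α * ∏ j, (1 + (ξ j) ^ 2) ^ ((δ - (α j : ℝ)) / 2)) →
      ∀ u₁ u₂ u₃ : SchwartzMap ℝ ℂ,
        HsNorm s (Cform c ⇑u₁ ⇑u₂ ⇑u₃) ≤ C' * HsNorm s ⇑u₁ * HsNorm s ⇑u₂ * HsNorm s ⇑u₃ := by
  obtain ⟨e, C, he, hC, hw⟩ := aux_weight δ s hδ hs hstrict
  set K := |cα 0| with hKdef
  have hK : 0 ≤ K := abs_nonneg _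
  set I : ℝ := ∫ x : ℝ, (1 + x^2)^e with hI
  have hIi : Integrable (fun x : ℝ => (1 + x^2)^e) := by
    have := integrable_rpow_neg_one_add_norm_sq (E := ℝ) (μ := volume) (r := -2*e)
      (by simp; linarith)
    refine this.congr (Filter.Eventually.of_forall fun x => ?_)
    simp only [Real.norm_eq_abs, sq_abs]
    congr 1; ring
  have hI0 : 0 ≤ I := integral_nonneg fun x => by positivity
  set M : ℝ := K^2 * C * (3 * I^2) with hM
  have hM0 : 0 ≤ M := by positivity
  refine ⟨Real.sqrt M * (2 * Real.pi), fun c hcd hcb u₁ u₂ u₃ => ?_⟩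
  have hcc : Continuous c := hcd.continuous
  have hc : ∀ x y z : ℝ, ‖c ![x, y, z]‖ ≤
      K * ((1+x^2)^(δ/2) * (1+y^2)^(δ/2) * (1+z^2)^(δ/2)) := by
    intro x y z
    have := hcb 0 ![x, y, z]
    simp [pdMulti, Fin.prod_univ_three] at this
    refine this.trans ?_
    gcongr
    exact le_abs_self _
  have hcK : ∀ ξ, ‖c ξ‖ ≤ K := by
    intro ξ
    have h := hc (ξ 0) (ξ 1) (ξ 2)
    have e1 : ![ξ 0, ξ 1, ξ 2] = ξ := by
      ext i; fin_cases i <;> rfl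
    rw [e1] at h
    have hle : ∀ x : ℝ, (1 + x^2)^(δ/2) ≤ 1 := fun x =>
      Real.rpow_le_one_of_one_le_of_nonpos (by nlinarith) (by linarith)
    refine h.trans (mul_le_of_le_one_right hK ?_)
    exact mul_le_one₀ (mul_le_one₀ (hle _) (by positivity) (hle _)) (by positivity) (hle _)
  obtain ⟨v₁, h₁⟩ := aux_schwartz u₁
  obtain ⟨v₂, h₂⟩ := aux_schwartz u₂
  obtain ⟨v₃, h₃⟩ := aux_schwartz u₃
  have hg : ∀ η, ‖FT (Cform c u₁ u₂ u₃) η‖ ≤ ‖∫ p : ℝ × ℝ, Phi c v₁ v₂ v₃ p η‖ := by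
    intro η
    by_cases hi : Integrable (Cform c u₁ u₂ u₃)
    · rw [FT_Cform c hcc K hcK u₁ u₂ u₃ v₁ v₂ v₃ h₁ h₂ h₃ hi η, norm_mul]
      refine mul_le_of_le_one_left (norm_nonneg _) ?_
      rw [norm_inv, Complex.norm_real, Real.norm_eq_abs, abs_of_nonneg (by positivity)]
      refine inv_le_one_of_one_le₀ ?_
      have := Real.pi_gt_three
      nlinarith
    · have : FT (Cform c u₁ u₂ u₃) η = 0 := by
        refine integral_undef fun hi' => hi ?_
        have hb := hi'.bdd_mul (c := 1)
          (f := fun x : ℝ => Complex.exp (Complex.I * (x : ℂ) * (η : ℂ)))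
          (Continuous.aestronglyMeasurable (by fun_prop))
          (Filter.Eventually.of_forall fun x => by
            rw [show Complex.I * x * η = ((x * η : ℝ) : ℂ) * Complex.I by push_cast; ring]
            exact (Complex.norm_exp_ofReal_mul_I _).le)
        refine hb.congr (Filter.Eventually.of_forall fun x => ?_)
        simp only
        rw [← mul_assoc, ← Complex.exp_add]
        simp
      rw [this, norm_zero]; exact norm_nonneg _
  have hmain := aux_main s δ e C K hC hK hw c hc v₁ v₂ v₃ _ hg
  have hN : ∀ v : SchwartzMap ℝ ℂ, ∫⁻ x : ℝ, ENNReal.ofReal ((1 + x^2)^s * ‖v x‖^2) =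
      ENNReal.ofReal (∫ x : ℝ, (1 + x^2)^s * ‖v x‖^2) := fun v =>
    (ofReal_integral_eq_lintegral_ofReal (aux_integrable s v)
      (Filter.Eventually.of_forall fun x => by positivity)).symm
  have hN0 : ∀ v : SchwartzMap ℝ ℂ, 0 ≤ ∫ x : ℝ, (1 + x^2)^s * ‖v x‖^2 := fun v =>
    integral_nonneg fun x => by positivity
  have hII : ∫⁻ x : ℝ, ENNReal.ofReal ((1 + x^2)^e) = ENNReal.ofReal I :=
    (ofReal_integral_eq_lintegral_ofReal hIi
      (Filter.Eventually.of_forall fun x => by positivity)).symm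
  have hreal : ∫ ξ : ℝ, ((1 + ξ ^ 2) ^ s) * ‖FT (Cform c u₁ u₂ u₃) ξ‖ ^ 2 ≤
      M * ((∫ x : ℝ, (1 + x^2)^s * ‖v₁ x‖^2) * (∫ x : ℝ, (1 + x^2)^s * ‖v₂ x‖^2) *
        (∫ x : ℝ, (1 + x^2)^s * ‖v₃ x‖^2)) := by
    have n1 := hN0 v₁
    have n2 := hN0 v₂
    have n3 := hN0 v₃
    rw [hN, hN, hN, hII, ← ENNReal.ofReal_pow hI0, ← ENNReal.ofReal_mul n1,
      ← ENNReal.ofReal_mul (by positivity), show (3 : ℝ≥0∞) = ENNReal.ofReal 3 by simp,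
      ← ENNReal.ofReal_mul (by norm_num), ← ENNReal.ofReal_mul (by positivity),
      ← ENNReal.ofReal_mul (by positivity)] at hmain
    by_cases hi : Integrable (fun ξ : ℝ => ((1 + ξ ^ 2) ^ s) * ‖FT (Cform c u₁ u₂ u₃) ξ‖ ^ 2)
    · rw [← ofReal_integral_eq_lintegral_ofReal hi
        (Filter.Eventually.of_forall fun x => by positivity)] at hmain
      exact (ENNReal.ofReal_le_ofReal_iff (by positivity)).1 hmain
    · rw [integral_undef hi]; positivity
  unfold HsNorm
  simp_rw [h₁, h₂, h₃]
  set N₁ := ∫ x : ℝ, (1 + x^2)^s * ‖v₁ x‖^2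
  set N₂ := ∫ x : ℝ, (1 + x^2)^s * ‖v₂ x‖^2
  set N₃ := ∫ x : ℝ, (1 + x^2)^s * ‖v₃ x‖^2
  have n1 : 0 ≤ N₁ := hN0 v₁
  have n2 : 0 ≤ N₂ := hN0 v₂
  have n3 : 0 ≤ N₃ := hN0 v₃
  have hpi := Real.pi_pos
  have e2 : Real.sqrt M * (2 * Real.pi) * √((2 * Real.pi)⁻¹ * N₁) * √((2 * Real.pi)⁻¹ * N₂) *
      √((2 * Real.pi)⁻¹ * N₃) = √((2 * Real.pi)⁻¹ * (M * (N₁ * N₂ * N₃))) := by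
    rw [← Real.sqrt_sq (by positivity : 0 ≤ 2 * Real.pi), ← Real.sqrt_mul hM0,
      Real.sqrt_sq (by positivity : 0 ≤ 2 * Real.pi),
      ← Real.sqrt_mul (by positivity), ← Real.sqrt_mul (by positivity),
      ← Real.sqrt_mul (by positivity)]
    congr 1
    field_simp
  rw [e2]
  exact Real.sqrt_le_sqrt (mul_le_mul_of_nonneg_left hreal (by positivity))
end
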